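/- arXiv:2507.02720 — 6 statements merged into one kernel-verified Lean document; each statement's English description precedes it below -/
import Mathlib

section
/- For every integer n ≥ 0 and every integer α ≥ 3, the number of (2^α, 3)-biregular overpartitions of 8n+6 is divisible by 8, i.e. B̄_{2^α,3}(8n+6) ≡ 0 (mod 8). -/
/-- The number of `(ℓ₁, ℓ₂)`-biregular overpartitions of `n`: an overpartition is a pair
`(s, t)` of multisets of positive parts, where `t` (the multiset of overlined parts) has
distinct parts, and the sizes sum to `n`; here additionally no part may be divisible by
`ℓ₁` or by `ℓ₂`. -/
noncomputable def biregularOverpartitions (ℓ₁ ℓ₂ n : ℕ) : ℕ :=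
  Set.ncard {p : Multiset ℕ × Multiset ℕ |
    (∀ x ∈ p.1, 0 < x ∧ ¬ ℓ₁ ∣ x ∧ ¬ ℓ₂ ∣ x) ∧
    (∀ x ∈ p.2, 0 < x ∧ ¬ ℓ₁ ∣ x ∧ ¬ ℓ₂ ∣ x) ∧
    p.2.Nodup ∧ p.1.sum + p.2.sum = n}

open Finset

section BiregAux

/-- partial product of `1 + q^i`, `1 ≤ i ≤ n` -/
def brE {R : Type*} [CommRing R] (q : R) (n : ℕ) : R := ∏ i ∈ range n, (1 + q ^ (i + 1))

/-- product of `1 - q^i`, `s < i ≤ n` -/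
def brQ {R : Type*} [CommRing R] (q : R) (n s : ℕ) : R := ∏ i ∈ Ico s n, (1 - q ^ (i + 1))

/-- truncated theta tail -/
def brU {R : Type*} [CommRing R] (q : R) (n : ℕ) : R :=
  ∑ s ∈ range n, (-1) ^ (s + 1) * q ^ ((s + 1) ^ 2)

def brt {R : Type*} [CommRing R] (q : R) (n s : ℕ) : R :=
  2 * (-1) ^ (s + 1) * q ^ ((s + 1) * (n + 1)) * brE q s * brQ q n (s + 1)

lemma brE_succ {R : Type*} [CommRing R] (q : R) (n : ℕ) :
    brE q (n + 1) = brE q n * (1 + q ^ (n + 1)) := by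
  simp [brE, prod_range_succ]

lemma brQ_succ {R : Type*} [CommRing R] (q : R) (n s : ℕ) (h : s ≤ n) :
    brQ q (n + 1) s = brQ q n s * (1 - q ^ (n + 1)) := by
  simp [brQ, prod_Ico_succ_top h]

lemma brQ_left {R : Type*} [CommRing R] (q : R) (n s : ℕ) (h : s < n) :
    brQ q n s = (1 - q ^ (s + 1)) * brQ q n (s + 1) := by
  simp [brQ, prod_eq_prod_Ico_succ_bot h]

lemma br_tele {R : Type*} [CommRing R] (q : R) (n m : ℕ) (h : m ≤ n) :
    brQ q (n + 1) 0 - (1 + q ^ (n + 1)) * brQ q n 0 +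
      ∑ s ∈ range m, (brt q (n + 1) s - (1 + q ^ (n + 1)) * brt q n s) =
      - (2 * (-1) ^ m * q ^ ((m + 1) * (n + 1)) * brE q m * brQ q n m) := by
  induction m with
  | zero =>
    rw [brQ_succ q n 0 (by omega)]
    simp [brE]
    ring
  | succ m ih =>
    rw [sum_range_succ, ← add_assoc, ih (by omega)]
    simp only [brt]
    rw [brQ_left q n m (by omega), brQ_succ q n (m + 1) h, brE_succ]
    ring

lemma br_gauss {R : Type*} [CommRing R] (q : R) (n : ℕ) :
    (1 + 2 * brU q n) * brE q n = brQ q n 0 + ∑ s ∈ range n, brt q n s := by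
  induction n with
  | zero => simp [brU, brE, brQ]
  | succ n ih =>
    have h := br_tele q n n le_rfl
    rw [sum_sub_distrib, ← mul_sum] at h
    have hq : brQ q n n = 1 := by simp [brQ]
    rw [hq] at h
    rw [sum_range_succ]
    have hU : brU q (n + 1) = brU q n + (-1) ^ (n + 1) * q ^ ((n + 1) ^ 2) := by
      simp [brU, sum_range_succ]
    have hq' : brQ q (n + 1) (n + 1) = 1 := by simp [brQ]
    have e : brt q (n + 1) n = 2 * (-1) ^ (n + 1) * q ^ ((n + 1) * (n + 1 + 1)) * brE q n := by
      simp [brt, hq']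
    rw [e, hU, brE_succ]
    linear_combination (1 + q ^ (n + 1)) * ih - h

lemma br_gauss_dvd {R : Type*} [CommRing R] (q : R) (n : ℕ) :
    q ^ (n + 1) ∣ (1 + 2 * brU q n) * brE q n - brQ q n 0 := by
  rw [br_gauss, add_sub_cancel_left]
  refine dvd_sum fun s _ => ?_
  have : q ^ (n + 1) ∣ q ^ ((s + 1) * (n + 1)) := pow_dvd_pow _ (by nlinarith)
  unfold brt
  exact Dvd.dvd.mul_right (Dvd.dvd.mul_right (Dvd.dvd.mul_left this _) _) _

lemma br_alg {R : Type*} [CommRing R] (p T T3 ES E3 El DS D3 Dl : R)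
    (h1 : p * DS = ES) (h2 : T * (ES * E3 * El) = DS * D3 * Dl) (h3 : T3 * E3 = D3)
    (hT : T ^ 4 = 1) (u1 : IsUnit ES) (u2 : IsUnit E3) :
    p * El = T3 * T ^ 3 * Dl := by
  have h : (ES * E3) * (p * T * El) = (ES * E3) * (T3 * Dl) := by
    linear_combination p * h2 + D3 * Dl * h1 - ES * Dl * h3
  have h' := (u1.mul u2).mul_left_cancel h
  linear_combination T ^ 3 * h' - p * El * hT

open PowerSeries in
/-- support condition: only exponents divisible by 8 -/
def brS8 (f : PowerSeries (ZMod 8)) : Prop := ∀ n, ¬ 8 ∣ n → coeff n f = 0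

lemma brS8_one : brS8 1 := by
  intro n hn
  rw [PowerSeries.coeff_one, if_neg]
  rintro rfl
  simp at hn

lemma brS8_mul {f g} (hf : brS8 f) (hg : brS8 g) : brS8 (f * g) := by
  intro n hn
  rw [PowerSeries.coeff_mul]
  refine sum_eq_zero fun ij hij => ?_
  rw [HasAntidiagonal.mem_antidiagonal] at hij
  by_cases h : 8 ∣ ij.1
  · rw [hg ij.2 (by omega), mul_zero]
  · rw [hf _ h, zero_mul]

lemma brS8_prod (s : Finset ℕ) (F : ℕ → PowerSeries (ZMod 8)) (h : ∀ i ∈ s, brS8 (F i)) :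
    brS8 (∏ i ∈ s, F i) :=
  prod_induction _ _ (fun _ _ => brS8_mul) brS8_one h

lemma brS8_add (i : ℕ) (h : 8 ∣ i) : brS8 (1 + PowerSeries.X ^ i) := by
  intro n hn
  rw [map_add, brS8_one n hn, PowerSeries.coeff_X_pow, if_neg (by rintro rfl; exact hn h), add_zero]

lemma brS8_sub (i : ℕ) (h : 8 ∣ i) : brS8 (1 - PowerSeries.X ^ i) := by
  intro n hn
  rw [map_sub, brS8_one n hn, PowerSeries.coeff_X_pow, if_neg (by rintro rfl; exact hn h), sub_zero]

open PowerSeries in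
lemma br_descend (p E G D : PowerSeries (ZMod 8)) (N : ℕ) (hE : brS8 E) (hE0 : coeff 0 E = 1)
    (hD : brS8 D) (hG : ∀ k, coeff (8 * k + 6) G = 0)
    (h : ∀ m ≤ N, coeff m (p * E) = coeff m (G * D)) (k : ℕ) (hk : 8 * k + 6 ≤ N) :
    coeff (8 * k + 6) p = 0 := by
  induction k using Nat.strong_induction_on with
  | _ k ih =>
    have h1 : coeff (8 * k + 6) (G * D) = 0 := by
      rw [coeff_mul]
      refine sum_eq_zero fun ij hij => ?_
      rw [HasAntidiagonal.mem_antidiagonal] at hij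
      by_cases h : 8 ∣ ij.2
      · obtain ⟨c, hc⟩ := h
        have : ij.1 = 8 * (k - c) + 6 := by omega
        rw [this, hG, zero_mul]
      · rw [hD _ h, mul_zero]
    have h2 := h _ hk
    rw [h1, coeff_mul, sum_eq_single (8 * k + 6, 0)] at h2
    · simpa [hE0] using h2
    · rintro ⟨i, j⟩ hij hne
      rw [HasAntidiagonal.mem_antidiagonal] at hij
      simp only at hij ⊢
      by_cases h : 8 ∣ j
      · obtain ⟨c, hc⟩ := h
        have hc0 : c ≠ 0 := by
          rintro rfl
          apply hne
          ext <;> simp <;> omega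
        have : i = 8 * (k - c) + 6 := by omega
        rw [this, ih (k - c) (by omega) (by omega), zero_mul]
      · rw [hE _ h, mul_zero]
    · intro h
      simp at h

lemma br_sq_mod (x : ℕ) : x ^ 2 % 8 = 0 ∨ x ^ 2 % 8 = 1 ∨ x ^ 2 % 8 = 4 := by
  have : x % 8 < 8 := Nat.mod_lt _ (by norm_num)
  rw [Nat.pow_mod]
  generalize x % 8 = y at *
  interval_cases y <;> simp

open PowerSeries in
lemma br_cU (d : ℕ) (n m : ℕ) (h : ∀ s, d * s ^ 2 ≠ m) :
    coeff m (brU (X ^ d : PowerSeries (ZMod 8)) n) = 0 := by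
  unfold brU
  rw [map_sum]
  refine sum_eq_zero fun s _ => ?_
  rw [← pow_mul, show ((-1 : PowerSeries (ZMod 8)) ^ (s + 1)) = C ((-1) ^ (s + 1)) by simp,
    coeff_C_mul, coeff_X_pow, if_neg (fun e => h _ e.symm), mul_zero]

open PowerSeries in
lemma br_cUU (d e : ℕ) (n n' m : ℕ) (h : ∀ s t, d * s ^ 2 + e * t ^ 2 ≠ m) :
    coeff m (brU (X ^ d : PowerSeries (ZMod 8)) n * brU (X ^ e : PowerSeries (ZMod 8)) n') = 0 := by
  rw [coeff_mul]
  refine sum_eq_zero fun ij hij => ?_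
  rw [HasAntidiagonal.mem_antidiagonal] at hij
  by_cases hh : ∃ s, d * s ^ 2 = ij.1
  · obtain ⟨s, hs⟩ := hh
    rw [br_cU e _ ij.2, mul_zero]
    intro t ht
    exact h s t (by omega)
  · push Not at hh
    rw [br_cU d _ ij.1 hh, zero_mul]

lemma br_eight : (8 : PowerSeries (ZMod 8)) = 0 := by
  have : (8 : PowerSeries (ZMod 8)) = PowerSeries.C (8 : ZMod 8) :=
    (map_ofNat (PowerSeries.C (R := ZMod 8)) 8).symm
  rw [this, show (8 : ZMod 8) = 0 from rfl, map_zero]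

open PowerSeries in
lemma br_G (n n' k : ℕ) : coeff (8 * k + 6)
    ((1 + 2 * brU (X ^ 3 : PowerSeries (ZMod 8)) n') *
      (1 + 2 * brU (X ^ 1 : PowerSeries (ZMod 8)) n) ^ 3) = 0 := by
  have key : ∀ U V : PowerSeries (ZMod 8), (1 + 2 * V) * (1 + 2 * U) ^ 3 =
      1 + C 6 * U + C 4 * (U * U) + C 2 * V + C 4 * (U * V) := by
    intro U V
    simp only [map_ofNat]
    linear_combination (U ^ 2 + U * V + 3 * U ^ 2 * V + U ^ 3 + 2 * U ^ 3 * V) * br_eight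
  rw [key]
  simp only [map_add, coeff_C_mul]
  rw [br_cU, br_cU, br_cUU, br_cUU, coeff_one]
  · simp
  all_goals
    intro s
    try intro t
    have := br_sq_mod s
    try have := br_sq_mod t
    omega

open PowerSeries in
lemma br_T4 (U : PowerSeries (ZMod 8)) : (1 + 2 * U) ^ 4 = 1 := by
  linear_combination (U + 3 * U ^ 2 + 4 * U ^ 3 + 2 * U ^ 4) * br_eight

/-! counting -/

lemma br_fin (A : Finset ℕ) (hA : 0 ∉ A) (n : ℕ) :
    {s : Multiset ℕ | (∀ x ∈ s, x ∈ A) ∧ s.sum = n}.Finite := by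
  refine (Set.finite_range (fun p : n.Partition => p.parts)).subset ?_
  rintro s ⟨h1, h2⟩
  refine ⟨⟨s, ?_, h2⟩, rfl⟩
  intro i hi
  exact Nat.pos_of_ne_zero (fun h => hA (h ▸ h1 i hi))

noncomputable def bra (A : Finset ℕ) (n : ℕ) : ℕ :=
  {s : Multiset ℕ | (∀ x ∈ s, x ∈ A) ∧ s.sum = n}.ncard

lemma bra_empty (n : ℕ) : bra ∅ n = if n = 0 then 1 else 0 := by
  unfold bra
  split_ifs with h
  · subst h
    have : {s : Multiset ℕ | (∀ x ∈ s, x ∈ (∅ : Finset ℕ)) ∧ s.sum = 0} = {0} := by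
      ext s
      simp only [Finset.notMem_empty, Set.mem_ofPred_eq, Set.mem_singleton_iff]
      constructor
      · rintro ⟨h, -⟩
        exact Multiset.eq_zero_of_forall_notMem h
      · rintro rfl
        simp
    rw [this, Set.ncard_singleton]
  · have : {s : Multiset ℕ | (∀ x ∈ s, x ∈ (∅ : Finset ℕ)) ∧ s.sum = n} = ∅ := by
      ext s
      simp only [Finset.notMem_empty, Set.mem_ofPred_eq, Set.mem_empty_iff_false, iff_false]
      rintro ⟨h1, h2⟩
      rw [Multiset.eq_zero_of_forall_notMem h1] at h2
      simp at h2
      exact h h2.symm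
    rw [this, Set.ncard_empty]

lemma bra_insert (A : Finset ℕ) (hA : 0 ∉ A) (k : ℕ) (hk : k ∉ A) (hk0 : k ≠ 0) (n : ℕ) :
    bra (insert k A) n = bra A n + if k ≤ n then bra (insert k A) (n - k) else 0 := by
  have hA' : 0 ∉ insert k A := by simp [hA, Ne.symm hk0]
  have e : {s : Multiset ℕ | (∀ x ∈ s, x ∈ insert k A) ∧ s.sum = n} =
      {s : Multiset ℕ | (∀ x ∈ s, x ∈ A) ∧ s.sum = n} ∪
      (fun s => k ::ₘ s) '' {s : Multiset ℕ | (∀ x ∈ s, x ∈ insert k A) ∧ k + s.sum = n} := by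
    ext s
    simp only [Set.mem_ofPred_eq, Set.mem_union, Set.mem_image]
    constructor
    · rintro ⟨h1, h2⟩
      by_cases hs : k ∈ s
      · right
        obtain ⟨t, rfl⟩ := Multiset.exists_cons_of_mem hs
        exact ⟨t, ⟨fun x hx => h1 x (Multiset.mem_cons_of_mem hx), by simpa using h2⟩, rfl⟩
      · left
        refine ⟨fun x hx => ?_, h2⟩
        rcases Finset.mem_insert.1 (h1 x hx) with rfl | h
        · exact absurd hx hs
        · exact h
    · rintro (⟨h1, h2⟩ | ⟨t, ⟨h1, h2⟩, rfl⟩)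
      · exact ⟨fun x hx => Finset.mem_insert_of_mem (h1 x hx), h2⟩
      · refine ⟨fun x hx => ?_, by simpa using h2⟩
        rcases Multiset.mem_cons.1 hx with rfl | h
        · exact Finset.mem_insert_self _ _
        · exact h1 x h
  have hfin : {s : Multiset ℕ | (∀ x ∈ s, x ∈ insert k A) ∧ k + s.sum = n}.Finite := by
    refine (br_fin (insert k A) hA' (n - k)).subset ?_
    rintro s ⟨h1, h2⟩
    exact ⟨h1, by omega⟩
  unfold bra
  rw [e, Set.ncard_union_eq ?_ (br_fin A hA n) (hfin.image _),
    Set.ncard_image_of_injective _ (fun a b h => (Multiset.cons_inj_right k).1 h)]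
  · congr 1
    split_ifs with h
    · congr 1
      ext s
      simp only [Set.mem_ofPred_eq]
      refine and_congr_right fun _ => ?_
      omega
    · rw [Set.ncard_eq_zero hfin]
      ext s
      simp only [Set.mem_ofPred_eq, Set.mem_empty_iff_false, iff_false]
      rintro ⟨-, h2⟩
      omega
  · rw [Set.disjoint_left]
    rintro s ⟨h1, -⟩ ⟨t, -, rfl⟩
    exact hk (h1 k (Multiset.mem_cons_self _ _))

open PowerSeries in
lemma bra_series (A : Finset ℕ) (hA : 0 ∉ A) :
    (PowerSeries.mk fun n => (bra A n : ZMod 8)) * ∏ i ∈ A, (1 - X ^ i) = 1 := by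
  induction A using Finset.induction_on with
  | empty =>
    ext n
    simp [bra_empty, coeff_one]
  | insert k A hk ih =>
    have hA0 : 0 ∉ A := fun h => hA (Finset.mem_insert_of_mem h)
    have hk0 : k ≠ 0 := by rintro rfl; exact hA (Finset.mem_insert_self _ _)
    rw [prod_insert hk, ← mul_assoc]
    have : (PowerSeries.mk fun n => (bra (insert k A) n : ZMod 8)) * (1 - X ^ k) =
        PowerSeries.mk fun n => (bra A n : ZMod 8) := by
      ext n
      rw [mul_sub, mul_one, map_sub, coeff_mul_X_pow', coeff_mk, coeff_mk, bra_insert A hA0 k hk hk0]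
      split_ifs <;> simp
    rw [this, ih hA0]

def brb (A : Finset ℕ) (n : ℕ) : ℕ := (A.powerset.filter (fun t => ∑ i ∈ t, i = n)).card

open PowerSeries in
lemma brb_series (A : Finset ℕ) :
    (PowerSeries.mk fun n => (brb A n : ZMod 8)) = ∏ i ∈ A, (1 + X ^ i) := by
  rw [prod_one_add]
  ext n
  simp only [map_sum, coeff_mk, brb]
  rw [card_filter]
  push_cast
  refine sum_congr rfl fun t _ => ?_
  rw [prod_pow_eq_pow_sum t (fun i => i) X, coeff_X_pow]
  simp [eq_comm]

lemma br_count (ℓ₁ ℓ₂ N : ℕ) :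
    biregularOverpartitions ℓ₁ ℓ₂ N = ∑ ij ∈ HasAntidiagonal.antidiagonal N,
      bra ((Icc 1 N).filter fun x => ¬ ℓ₁ ∣ x ∧ ¬ ℓ₂ ∣ x) ij.1 *
      brb ((Icc 1 N).filter fun x => ¬ ℓ₁ ∣ x ∧ ¬ ℓ₂ ∣ x) ij.2 := by
  classical
  set A := (Icc 1 N).filter fun x => ¬ ℓ₁ ∣ x ∧ ¬ ℓ₂ ∣ x with hAdef
  have hA : 0 ∉ A := by simp [hAdef]
  set Fa : ℕ → Finset (Multiset ℕ) := fun n => (br_fin A hA n).toFinset with hFa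
  set Fb : ℕ → Finset (Multiset ℕ) := fun n =>
    (A.powerset.filter (fun t => ∑ i ∈ t, i = n)).image Finset.val with hFb
  have hmemA : ∀ x, x ∈ A ↔ x ≤ N ∧ (0 < x ∧ ¬ ℓ₁ ∣ x ∧ ¬ ℓ₂ ∣ x) := by
    intro x
    simp only [hAdef, mem_filter, mem_Icc]
    constructor
    · rintro ⟨⟨h1, h2⟩, h3⟩
      exact ⟨h2, h1, h3⟩
    · rintro ⟨h2, h1, h3⟩
      exact ⟨⟨h1, h2⟩, h3⟩
  have memFa : ∀ n s, s ∈ Fa n ↔ (∀ x ∈ s, x ∈ A) ∧ s.sum = n := by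
    intro n s
    simp [hFa]
  have memFb : ∀ n t, t ∈ Fb n ↔ (∀ x ∈ t, x ∈ A) ∧ t.Nodup ∧ t.sum = n := by
    intro n t
    simp only [hFb, mem_image, mem_filter, mem_powerset]
    constructor
    · rintro ⟨u, ⟨h1, h2⟩, rfl⟩
      refine ⟨fun x hx => h1 hx, u.nodup, ?_⟩
      rw [← h2, Finset.sum_eq_multiset_sum, Multiset.map_id']
    · rintro ⟨h1, h2, h3⟩
      refine ⟨⟨t, h2⟩, ⟨fun x hx => h1 x hx, ?_⟩, rfl⟩
      rw [← h3, Finset.sum_eq_multiset_sum, Multiset.map_id']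
  have cFa : ∀ n, (Fa n).card = bra A n := by
    intro n
    rw [bra, Set.ncard_eq_toFinset_card _ (br_fin A hA n)]
  have cFb : ∀ n, (Fb n).card = brb A n := by
    intro n
    exact card_image_of_injective _ Finset.val_injective
  have hset : {p : Multiset ℕ × Multiset ℕ |
    (∀ x ∈ p.1, 0 < x ∧ ¬ ℓ₁ ∣ x ∧ ¬ ℓ₂ ∣ x) ∧
    (∀ x ∈ p.2, 0 < x ∧ ¬ ℓ₁ ∣ x ∧ ¬ ℓ₂ ∣ x) ∧
    p.2.Nodup ∧ p.1.sum + p.2.sum = N} =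
    ↑((HasAntidiagonal.antidiagonal N).biUnion fun ij => Fa ij.1 ×ˢ Fb ij.2) := by
    ext ⟨s, t⟩
    simp only [Set.mem_ofPred_eq, coe_biUnion, Set.mem_iUnion, mem_coe, HasAntidiagonal.mem_antidiagonal,
      mem_product, memFa, memFb, exists_prop, Prod.exists]
    constructor
    · rintro ⟨h1, h2, h3, h4⟩
      refine ⟨s.sum, t.sum, h4, ⟨fun x hx => ?_, rfl⟩, fun x hx => ?_, h3, rfl⟩
      · have := Multiset.le_sum_of_mem hx
        exact (hmemA x).2 ⟨by omega, h1 x hx⟩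
      · have := Multiset.le_sum_of_mem hx
        exact (hmemA x).2 ⟨by omega, h2 x hx⟩
    · rintro ⟨i, j, hij, ⟨h1, rfl⟩, h2, h3, rfl⟩
      exact ⟨fun x hx => ((hmemA x).1 (h1 x hx)).2, fun x hx => ((hmemA x).1 (h2 x hx)).2, h3, hij⟩
  unfold biregularOverpartitions
  rw [hset, Set.ncard_coe_finset, card_biUnion]
  · refine sum_congr rfl fun ij _ => ?_
    rw [card_product, cFa, cFb]
  · intro a _ b _ hab
    rw [Function.onFun, Finset.disjoint_left]
    rintro ⟨s, t⟩ h1 h2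
    simp only [mem_product, memFa, memFb] at h1 h2
    apply hab
    ext
    · exact h1.1.2.symm.trans h2.1.2
    · exact h1.2.2.2.symm.trans h2.2.2.2

lemma br_prod3 {R : Type*} [CommRing R] (N : ℕ) (F : ℕ → R) :
    ∏ i ∈ (Icc 1 N).filter (fun x => 3 ∣ x), F i = ∏ j ∈ range (N / 3), F (3 * (j + 1)) := by
  symm
  apply prod_bij (fun j _ => 3 * (j + 1))
  · intro j hj
    simp only [mem_range, mem_filter, mem_Icc] at *
    omega
  · intro a _ b _ h
    omega
  · intro b hb
    simp only [mem_range, mem_filter, mem_Icc] at *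
    exact ⟨b / 3 - 1, by omega, by omega⟩
  · intros
    rfl

lemma br_split {R : Type*} [CommRing R] (N L : ℕ) (F : ℕ → R) :
    ∏ i ∈ range N, F (i + 1) =
      (∏ i ∈ (Icc 1 N).filter (fun x => ¬ L ∣ x ∧ ¬ 3 ∣ x), F i) *
      (∏ j ∈ range (N / 3), F (3 * (j + 1))) *
      (∏ i ∈ (Icc 1 N).filter (fun x => L ∣ x ∧ ¬ 3 ∣ x), F i) := by
  have h0 : ∏ i ∈ range N, F (i + 1) = ∏ i ∈ Icc 1 N, F i := by
    rw [range_eq_Ico, prod_Ico_add' F 0 N 1]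
    rfl
  rw [h0, ← br_prod3, ← prod_filter_mul_prod_filter_not (Icc 1 N) (fun x => 3 ∣ x),
    ← prod_filter_mul_prod_filter_not ((Icc 1 N).filter (fun x => ¬ 3 ∣ x)) (fun x => L ∣ x),
    filter_filter, filter_filter]
  simp only [and_comm]
  ring

open PowerSeries in
lemma br_unit (s : Finset ℕ) (h : 0 ∉ s) :
    constantCoeff (∏ i ∈ s, (1 + (X : PowerSeries (ZMod 8)) ^ i)) = 1 := by
  rw [map_prod]
  refine prod_eq_one fun i hi => ?_
  have : i ≠ 0 := by rintro rfl; exact h hi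
  simp [this]

end BiregAux

open PowerSeries in
theorem biregular_overpartition_pow2_3_8n6_mod8 (n α : ℕ) (hα : 3 ≤ α) :
    8 ∣ biregularOverpartitions (2 ^ α) 3 (8 * n + 6) := by
  set N := 8 * n + 6 with hN
  set L := 2 ^ α with hL
  have hL8 : 8 ∣ L := by
    rw [hL]
    exact pow_dvd_pow 2 hα
  rw [← ZMod.natCast_eq_zero_iff, br_count]
  set A := (Icc 1 N).filter fun x => ¬ L ∣ x ∧ ¬ 3 ∣ x with hA
  set B := (Icc 1 N).filter fun x => L ∣ x ∧ ¬ 3 ∣ x with hB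
  have hA0 : 0 ∉ A := by simp [hA]
  have hB0 : 0 ∉ B := by simp [hB]
  have hB8 : ∀ i ∈ B, 8 ∣ i := by
    intro i hi
    rw [hB, mem_filter] at hi
    exact hL8.trans hi.2.1
  set p : PowerSeries (ZMod 8) := (PowerSeries.mk fun n => (bra A n : ZMod 8)) *
    (PowerSeries.mk fun n => (brb A n : ZMod 8)) with hp
  have hcoef : ((∑ ij ∈ HasAntidiagonal.antidiagonal N, bra A ij.1 * brb A ij.2 : ℕ) : ZMod 8) = coeff N p := by
    rw [hp, coeff_mul]
    simp
  rw [hcoef]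
  have h1 : p * ∏ i ∈ A, (1 - X ^ i) = ∏ i ∈ A, (1 + X ^ i) := by
    rw [hp, ← brb_series]
    linear_combination (PowerSeries.mk fun n => (brb A n : ZMod 8)) * bra_series A hA0
  set I : Ideal (PowerSeries (ZMod 8)) := Ideal.span {X ^ (N + 1)} with hI
  set φ := Ideal.Quotient.mk I with hφ
  have hmk : ∀ a b : PowerSeries (ZMod 8), φ a = φ b ↔ X ^ (N + 1) ∣ a - b := by
    intro a b
    rw [hφ, Ideal.Quotient.eq, hI, Ideal.mem_span_singleton]
  have h2 : φ ((1 + 2 * brU (X ^ 1) N) * ((∏ i ∈ A, (1 + X ^ i)) *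
      brE (X ^ 3) (N / 3) * ∏ i ∈ B, (1 + X ^ i))) =
      φ ((∏ i ∈ A, (1 - X ^ i)) * brQ (X ^ 3) (N / 3) 0 * ∏ i ∈ B, (1 - X ^ i)) := by
    rw [hmk]
    have := br_gauss_dvd (X ^ 1 : PowerSeries (ZMod 8)) N
    have e1 := br_split N L (fun i => 1 + (X : PowerSeries (ZMod 8)) ^ i)
    have e2 := br_split N L (fun i => 1 - (X : PowerSeries (ZMod 8)) ^ i)
    simp only [brE, brQ, Nat.Ico_zero_eq_range, ← pow_mul, one_mul] at this ⊢
    rw [e1, e2] at this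
    exact this
  have h3 : φ ((1 + 2 * brU (X ^ 3) (N / 3)) * brE (X ^ 3) (N / 3)) =
      φ (brQ (X ^ 3) (N / 3) 0) := by
    rw [hmk]
    refine dvd_trans ?_ (br_gauss_dvd (X ^ 3 : PowerSeries (ZMod 8)) (N / 3))
    rw [← pow_mul]
    exact pow_dvd_pow _ (by omega)
  have u1 : IsUnit (∏ i ∈ A, (1 + (X : PowerSeries (ZMod 8)) ^ i)) := by
    rw [isUnit_iff_constantCoeff, br_unit A hA0]
    exact isUnit_one
  have u2 : IsUnit (brE (X ^ 3 : PowerSeries (ZMod 8)) (N / 3)) := by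
    rw [isUnit_iff_constantCoeff]
    simp [brE, map_prod]
  have key := br_alg (φ p) (φ (1 + 2 * brU (X ^ 1) N)) (φ (1 + 2 * brU (X ^ 3) (N / 3)))
    (φ (∏ i ∈ A, (1 + X ^ i))) (φ (brE (X ^ 3) (N / 3))) (φ (∏ i ∈ B, (1 + X ^ i)))
    (φ (∏ i ∈ A, (1 - X ^ i))) (φ (brQ (X ^ 3) (N / 3) 0)) (φ (∏ i ∈ B, (1 - X ^ i)))
    (by rw [← map_mul, h1]) (by simpa only [map_mul] using h2) (by simpa only [map_mul] using h3)
    (by rw [← map_pow, br_T4, map_one]) (u1.map φ) (u2.map φ)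
  simp only [← map_mul, ← map_pow] at key
  rw [hmk, X_pow_dvd_iff] at key
  refine br_descend p _ _ _ N (brS8_prod B _ fun i hi => brS8_add i (hB8 i hi)) ?_
    (brS8_prod B _ fun i hi => brS8_sub i (hB8 i hi)) (br_G N (N / 3)) ?_ n le_rfl
  · rw [coeff_zero_eq_constantCoeff_apply, br_unit B hB0]
  · intro m hm
    have := key m (by omega)
    rw [map_sub, sub_eq_zero] at this
    exact this
end

section
/- For all integers n ≥ 0 and k ≥ 0, and every integer α > 2k+1, the number of (2^α, 3)-biregular overpartitions of 4^k·(4n+3) is divisible by 6, i.e. B̄_{2^α,3}(4^k(4n+3)) ≡ 0 (mod 6). -/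
open Finset PowerSeries

section Count
open PowerSeries.WithPiTopology

theorem geo_one {R : Type*} [CommRing R] {m : ℕ} (hm : m ≠ 0) :
    (1 - X ^ m) * (expand m hm (PowerSeries.mk (1 : ℕ → R))) = 1 := by
  have := congrArg (expand m hm) (PowerSeries.mk_one_mul_one_sub_eq_one R)
  simpa [mul_comm] using this

noncomputable def bser (R : Type*) [CommRing R] (m : ℕ) : R⟦X⟧ :=
  if hm : m ≠ 0 then expand m hm (PowerSeries.mk (1 : ℕ → R)) else 1

theorem bser_mul {R : Type*} [CommRing R] (m : ℕ) :
    (1 - X ^ (m + 1)) * bser R (m + 1) = 1 := by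
  rw [bser, dif_pos (by omega)]; exact geo_one _

def dres (n : ℕ) (p : ℕ → Prop) [DecidablePred p] : Finset n.Partition :=
  Finset.univ.filter fun x ↦ ∀ i ∈ x.parts, p i ∧ x.parts.count i < 2

theorem hasProd_dres (R : Type*) [CommRing R] [TopologicalSpace R] [T2Space R]
    (p : ℕ → Prop) [DecidablePred p] :
    HasProd (fun i ↦ if p (i + 1) then 1 + X ^ (i + 1) else 1)
    (PowerSeries.mk fun n ↦ (#(dres n p) : R)) := by
  convert! Nat.Partition.hasProd_genFun (fun i c ↦ if p i ∧ c < 2 then (1 : R) else 0) using 1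
  · ext1 i
    split_ifs with h
    · rw [tsum_eq_single 0]
      · simp [h]
      · intro b hb
        simp [hb]
    · simp [h]
  · simp_rw [Nat.Partition.genFun, dres, card_filter, Finsupp.prod, prod_boole]
    simp

theorem hasProd_res (R : Type*) [CommRing R] [TopologicalSpace R] [T2Space R]
    [IsTopologicalRing R] (p : ℕ → Prop) [DecidablePred p] :
    HasProd (fun i ↦ if p (i + 1) then bser R (i + 1) else 1)
    (PowerSeries.mk fun n ↦ (#(Nat.Partition.restricted n p) : R)) := by
  have e : (fun i ↦ if p (i + 1) then bser R (i + 1) else 1) =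
      (fun i ↦ if p (i + 1) then ∑' j : ℕ, (X : R⟦X⟧) ^ ((i + 1) * j) else 1) := by
    funext i
    congr 1
    have h1 := bser_mul (R := R) i
    have h2 := tsum_pow_mul_one_sub_of_constantCoeff_eq_zero (R := R) (f := X ^ (i + 1)) (by simp)
    simp_rw [← pow_mul] at h2
    linear_combination (-bser R (i+1)) * h2 + (∑' j, X ^ ((i + 1) * j)) * h1
  rw [e]
  exact Nat.Partition.hasProd_powerSeriesMk_card_restricted R p

theorem count_eq (R : Type*) [CommRing R] (l1 l2 n : ℕ) :
    (biregularOverpartitions l1 l2 n : R) = coeff n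
      ((PowerSeries.mk fun n ↦ (#(Nat.Partition.restricted n (fun x => ¬ l1 ∣ x ∧ ¬ l2 ∣ x)) : R)) *
       (PowerSeries.mk fun n ↦ (#(dres n (fun x => ¬ l1 ∣ x ∧ ¬ l2 ∣ x)) : R))) := by
  rw [coeff_mul]
  simp only [coeff_mk]
  set p : ℕ → Prop := fun x => ¬ l1 ∣ x ∧ ¬ l2 ∣ x with hp
  norm_cast
  congr 1
  have hset : {q : Multiset ℕ × Multiset ℕ |
    (∀ x ∈ q.1, 0 < x ∧ ¬ l1 ∣ x ∧ ¬ l2 ∣ x) ∧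
    (∀ x ∈ q.2, 0 < x ∧ ¬ l1 ∣ x ∧ ¬ l2 ∣ x) ∧
    q.2.Nodup ∧ q.1.sum + q.2.sum = n} = (((antidiagonal n).biUnion fun ij =>
      ((Nat.Partition.restricted ij.1 p).image Nat.Partition.parts) ×ˢ
      ((dres ij.2 p).image Nat.Partition.parts) : Finset (Multiset ℕ × Multiset ℕ)) : Set _) := by
    ext ⟨s, t⟩
    simp only [Set.mem_ofPred_eq, coe_biUnion, Set.mem_iUnion, mem_coe, mem_product, mem_image,
      HasAntidiagonal.mem_antidiagonal, Nat.Partition.restricted, dres, mem_filter, mem_univ, true_and]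
    constructor
    · rintro ⟨h1, h2, h3, h4⟩
      refine ⟨(s.sum, t.sum), h4, ⟨⟨s, fun {i} hi => (h1 i hi).1, rfl⟩, fun i hi => (h1 i hi).2, rfl⟩,
        ⟨⟨t, fun {i} hi => (h2 i hi).1, rfl⟩, fun i hi => ⟨(h2 i hi).2, ?_⟩, rfl⟩⟩
      have := Multiset.nodup_iff_count_le_one.1 h3 i
      simp only
      omega
    · rintro ⟨⟨i, j⟩, hij, ⟨P, hP, rfl⟩, ⟨Q, hQ, rfl⟩⟩
      refine ⟨fun x hx => ⟨P.parts_pos hx, hP x hx⟩, fun x hx => ⟨Q.parts_pos hx, (hQ x hx).1⟩, ?_, ?_⟩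
      · rw [Multiset.nodup_iff_count_le_one]
        intro a
        by_cases ha : a ∈ Q.parts
        · have := (hQ a ha).2
          omega
        · simp [Multiset.count_eq_zero_of_notMem ha]
      · rw [P.parts_sum, Q.parts_sum]; exact hij
  rw [biregularOverpartitions, hset, Set.ncard_coe_finset, card_biUnion]
  · apply sum_congr rfl
    intro ij _
    rw [card_product, card_image_of_injective, card_image_of_injective]
    · intro a b h; exact Nat.Partition.ext h
    · intro a b h; exact Nat.Partition.ext h
  · intro x hx y hy hxy
    rw [Function.onFun, Finset.disjoint_left]
    rintro ⟨s, t⟩ h1 h2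
    simp only [mem_product, mem_image] at h1 h2
    obtain ⟨⟨P, _, hP⟩, ⟨Q, _, hQ⟩⟩ := h1
    obtain ⟨⟨P', _, hP'⟩, ⟨Q', _, hQ'⟩⟩ := h2
    apply hxy
    ext
    · rw [← P.parts_sum, ← P'.parts_sum, hP, hP']
    · rw [← Q.parts_sum, ← Q'.parts_sum, hQ, hQ']

theorem count_eventually (R : Type*) [CommRing R] (l1 l2 n : ℕ) :
    ∃ M, n ≤ M ∧ (biregularOverpartitions l1 l2 n : R) = coeff n
      (∏ i ∈ range M, if (¬ l1 ∣ (i + 1) ∧ ¬ l2 ∣ (i + 1)) then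
        ((1 + X ^ (i + 1)) * bser R (i + 1) : R⟦X⟧) else 1) := by
  let _ : TopologicalSpace R := ⊥
  have _ : DiscreteTopology R := ⟨rfl⟩
  have h := (hasProd_res R (fun x => ¬ l1 ∣ x ∧ ¬ l2 ∣ x)).mul
    (hasProd_dres R (fun x => ¬ l1 ∣ x ∧ ¬ l2 ∣ x))
  have h2 := (tendsto_iff_coeff_tendsto R _ _ _).1 h.tendsto_prod_nat n
  rw [nhds_discrete, Filter.tendsto_pure] at h2
  obtain ⟨M, hM, hM'⟩ := (h2.and (Filter.eventually_ge_atTop n)).exists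
  refine ⟨M, hM', ?_⟩
  rw [count_eq, ← hM]
  congr 1
  apply prod_congr rfl
  intro i _
  split_ifs <;> ring

theorem two_dvd_count (l1 l2 n : ℕ) (hn : n ≠ 0) : 2 ∣ biregularOverpartitions l1 l2 n := by
  rw [← ZMod.natCast_eq_zero_iff]
  obtain ⟨M, _, h⟩ := count_eventually (ZMod 2) l1 l2 n
  rw [h, prod_eq_one]
  · simp [coeff_one, hn]
  · intro i _
    have h2 : (2 : (ZMod 2)⟦X⟧) = 0 := by
      have : (2 : ZMod 2) = 0 := rfl
      rw [show (2 : (ZMod 2)⟦X⟧) = C (2 : ZMod 2) from (map_ofNat C 2).symm, this, map_zero]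
    split_ifs
    · linear_combination bser_mul (R := ZMod 2) i + X ^ (i + 1) * bser (ZMod 2) (i + 1) * h2
    · rfl
end Count

section Gauss
variable {R : Type*} [CommRing R]

def gU (q : R) (a : ℕ → R) (n : ℕ) : R := ∏ i ∈ range n, (1 - q ^ (i + 1)) * a (i + 1)
def gV (q : R) (b : ℕ → R) (n : ℕ) : R := ∏ i ∈ range n, (1 + q ^ (i + 1)) * b (i + 1)
def gS (q : R) (n : ℕ) : R := 1 + ∑ i ∈ range n, 2 * (-1) ^ (i + 1) * q ^ ((i + 1) ^ 2)
def gT (q : R) (a b : ℕ → R) (n j : ℕ) : R :=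
  ∑ s ∈ range j, (-1) ^ (s + 1) * gU q a n * gV q b (s + 1) * q ^ (n * (s + 1)) *
    (2 * q ^ (s + 1) * a (s + 1))

theorem gT_diff (q : R) (a b : ℕ → R) (ha : ∀ m, (1 + q ^ (m + 1)) * a (m + 1) = 1)
    (hb : ∀ m, (1 - q ^ (m + 1)) * b (m + 1) = 1) (n j : ℕ) :
    gT q a b (n + 1) j - gT q a b n j = 2 * gU q a n * a (n + 1) *
      (q ^ (n + 1) + (-1) ^ (j + 1) * q ^ ((n + 1) * (j + 1)) * gV q b j) := by
  induction j with
  | zero => simp [gT, gV]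
  | succ j ih =>
    have e1 : gT q a b (n + 1) (j + 1) = gT q a b (n + 1) j + (-1) ^ (j + 1) *
      gU q a (n + 1) * gV q b (j + 1) * q ^ ((n + 1) * (j + 1)) *
      (2 * q ^ (j + 1) * a (j + 1)) := by
      simp [gT, sum_range_succ]
    have e2 : gT q a b n (j + 1) = gT q a b n j + (-1) ^ (j + 1) *
      gU q a n * gV q b (j + 1) * q ^ (n * (j + 1)) *
      (2 * q ^ (j + 1) * a (j + 1)) := by
      simp [gT, sum_range_succ]
    have e3 : gU q a (n + 1) = gU q a n * ((1 - q ^ (n + 1)) * a (n + 1)) := by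
      simp [gU, prod_range_succ]
    have e4 : gV q b (j + 1) = gV q b j * ((1 + q ^ (j + 1)) * b (j + 1)) := by
      simp [gV, prod_range_succ]
    have p1 : q ^ ((n + 1) * (j + 1)) = q ^ (n * (j + 1)) * q ^ (j + 1) := by ring
    have p2 : q ^ ((n + 1) * (j + 1 + 1)) = q ^ (n * (j + 1)) * q ^ (j + 1) * q ^ (n + 1) := by
      ring
    have p3 : (-1 : R) ^ (j + 1 + 1) = - (-1) ^ (j + 1) := by ring
    have h1 := ha j
    have h2 := hb j
    have h3 := ha n
    rw [e1, e2, e3, p2, p3, e4]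
    rw [p1] at ih ⊢
    generalize (-1 : R) ^ (j + 1) = σ at *
    generalize q ^ (j + 1) = x at *
    generalize q ^ (n + 1) = y at *
    generalize q ^ (n * (j + 1)) = z at *
    generalize a (j + 1) = c at *
    generalize b (j + 1) = d at *
    generalize a (n + 1) = A at *
    generalize gU q a n = U at *
    generalize gV q b j = V at *
    linear_combination ih + (σ * U * V * z * 2 * x * d * ((1 - y) * A * x - 1)) * h1
      + (- 2 * σ * U * V * z * x * A) * h2 + (2 * σ * U * V * z * x * d) * h3

theorem gauss_finite (q : R) (a b : ℕ → R) (ha : ∀ m, (1 + q ^ (m + 1)) * a (m + 1) = 1)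
    (hb : ∀ m, (1 - q ^ (m + 1)) * b (m + 1) = 1) (n : ℕ) :
    gS q n = gU q a n + gT q a b n n := by
  have hUV : ∀ n, gU q a n * gV q b n = 1 := by
    intro n
    rw [gU, gV, ← prod_mul_distrib]
    apply prod_eq_one
    intro i _
    linear_combination (1 - q ^ (i+1)) * b (i+1) * ha i + hb i
  induction n with
  | zero => simp [gS, gU, gT]
  | succ n ih =>
    have e0 : gS q (n + 1) = gS q n + 2 * (-1) ^ (n + 1) * q ^ ((n + 1) ^ 2) := by
      simp [gS, sum_range_succ, add_assoc]
    have e1 : gT q a b (n + 1) (n + 1) = gT q a b (n + 1) n + (-1) ^ (n + 1) *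
      gU q a (n + 1) * gV q b (n + 1) * q ^ ((n + 1) * (n + 1)) *
      (2 * q ^ (n + 1) * a (n + 1)) := by
      simp [gT, sum_range_succ]
    have e3 : gU q a (n + 1) = gU q a n * ((1 - q ^ (n + 1)) * a (n + 1)) := by
      simp [gU, prod_range_succ]
    have hd := gT_diff q a b ha hb n n
    have h3 := ha n
    have u0 := hUV n
    have u1 := hUV (n + 1)
    rw [e0, e1]
    rw [show (n + 1) ^ 2 = (n + 1) * (n + 1) by ring]
    generalize q ^ ((n + 1) * (n + 1)) = w at *
    generalize (-1 : R) ^ (n + 1) = σ at *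
    generalize q ^ (n + 1) = y at *
    generalize a (n + 1) = A at *
    linear_combination ih - hd - e3 - (gU q a n + 2 * σ * w) * h3 - 2 * A * σ * w * u0 - σ * w * 2 * y * A * u1

theorem gauss_dvd (q : R) (a b : ℕ → R) (ha : ∀ m, (1 + q ^ (m + 1)) * a (m + 1) = 1)
    (hb : ∀ m, (1 - q ^ (m + 1)) * b (m + 1) = 1) (n : ℕ) :
    q ^ (n + 1) ∣ gS q n - gU q a n := by
  rw [gauss_finite q a b ha hb, add_sub_cancel_left]
  apply dvd_sum
  intro s _
  have : q ^ (n + 1) ∣ q ^ (n * (s + 1)) * q ^ (s + 1) := by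
    rw [← pow_add]
    apply pow_dvd_pow
    nlinarith
  obtain ⟨t, ht⟩ := this
  exact ⟨(-1) ^ (s + 1) * gU q a n * gV q b (s + 1) * 2 * a (s + 1) * t, by
    linear_combination (-1) ^ (s + 1) * gU q a n * gV q b (s + 1) * 2 * a (s + 1) * ht⟩
end Gauss

section Main

theorem sq_mod_four (x : ℕ) : (∃ u, x = 2 * u ∧ x ^ 2 = 4 * u ^ 2) ∨ (∃ t, x ^ 2 = 4 * t + 1) := by
  rcases Nat.even_or_odd' x with ⟨u, rfl | rfl⟩
  · exact Or.inl ⟨u, rfl, by ring⟩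
  · exact Or.inr ⟨u ^ 2 + u, by ring⟩

theorem not_two_sq (k : ℕ) : ∀ x y n : ℕ, x ^ 2 + y ^ 2 ≠ 4 ^ k * (4 * n + 3) := by
  induction k with
  | zero =>
    intro x y n h
    rw [pow_zero, one_mul] at h
    rcases sq_mod_four x with ⟨u, _, hu⟩ | ⟨u, hu⟩ <;>
    rcases sq_mod_four y with ⟨v, _, hv⟩ | ⟨v, hv⟩ <;> omega
  | succ k ih =>
    intro x y n h
    have e : 4 ^ (k + 1) * (4 * n + 3) = 4 * (4 ^ k * (4 * n + 3)) := by ring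
    have h0 := fun u v => ih u v n
    rw [e] at h
    generalize 4 ^ k * (4 * n + 3) = r at *
    rcases sq_mod_four x with ⟨u, _, hu⟩ | ⟨u, hu⟩ <;>
    rcases sq_mod_four y with ⟨v, _, hv⟩ | ⟨v, hv⟩ <;> try omega
    apply h0 u v
    omega

def SuppOn {K : Type*} [CommRing K] (l : ℕ) (f : K⟦X⟧) : Prop := ∀ n, coeff n f ≠ 0 → l ∣ n

theorem SuppOn.mul {K : Type*} [CommRing K] {l : ℕ} {f g : K⟦X⟧} (hf : SuppOn l f)
    (hg : SuppOn l g) : SuppOn l (f * g) := by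
  intro n hn
  rw [coeff_mul] at hn
  obtain ⟨ij, h1, h2⟩ := exists_ne_zero_of_sum_ne_zero hn
  rw [HasAntidiagonal.mem_antidiagonal] at h1
  rw [← h1]
  exact dvd_add (hf _ (left_ne_zero_of_mul h2)) (hg _ (right_ne_zero_of_mul h2))

theorem SuppOn.one {K : Type*} [CommRing K] {l : ℕ} : SuppOn l (1 : K⟦X⟧) := by
  intro n hn
  rw [coeff_one] at hn
  by_cases h : n = 0 <;> simp_all

theorem SuppOn.rv {K : Type*} [CommRing K] {l m : ℕ} (hm : m ≠ 0) (h : l ∣ m) :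
    SuppOn l ((1 + X ^ m) * bser K m : K⟦X⟧) := by
  apply SuppOn.mul
  · intro n hn
    rw [map_add, coeff_one, coeff_X_pow] at hn
    by_cases h1 : n = 0
    · simp [h1]
    · by_cases h2 : n = m
      · rwa [h2]
      · simp [h1, h2] at hn
  · intro n hn
    rw [bser, dif_pos hm, coeff_expand] at hn
    by_cases h1 : m ∣ n
    · exact h.trans h1
    · simp [h1] at hn

theorem coeff_gS {K : Type*} [CommRing K] (M n : ℕ) (h : coeff n (gS (X : K⟦X⟧) M) ≠ 0) :
    ∃ x, n = x ^ 2 := by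
  by_contra! hx
  apply h
  rw [gS, map_add, map_sum, coeff_one, if_neg (by simpa using hx 0), zero_add]
  apply sum_eq_zero
  intro i _
  have : (2 * (-1) ^ (i + 1) : K⟦X⟧) = C (2 * (-1) ^ (i + 1) : K) := by
    rw [map_mul, map_pow, map_neg, map_one, map_ofNat]
  rw [this, coeff_C_mul, coeff_X_pow, if_neg (hx _), mul_zero]

abbrev K3 := ZMod 3

noncomputable def aser (m : ℕ) : K3⟦X⟧ := (1 + X ^ m)⁻¹
noncomputable def rs (m : ℕ) : K3⟦X⟧ := (1 - X ^ m) * aser m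
noncomputable def rv (m : ℕ) : K3⟦X⟧ := (1 + X ^ m) * bser K3 m

theorem aser_mul (m : ℕ) : (1 + X ^ (m + 1)) * aser (m + 1) = 1 := by
  rw [aser]
  apply PowerSeries.mul_inv_cancel
  simp

theorem three_zero : (3 : K3⟦X⟧) = 0 := by
  have : (3 : K3) = 0 := rfl
  rw [show (3 : K3⟦X⟧) = C (3 : K3) from (map_ofNat C 3).symm, this, map_zero]

theorem rs_rv {m : ℕ} (hm : 1 ≤ m) : rs m * rv m = 1 := by
  obtain ⟨m, rfl⟩ := Nat.exists_eq_add_of_le' hm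
  rw [rs, rv]
  linear_combination (1 - X ^ (m+1)) * bser K3 (m+1) * aser_mul m + bser_mul (R := K3) m

theorem rs_cube {m : ℕ} (hm : 1 ≤ m) : rs m ^ 3 = rs (3 * m) := by
  obtain ⟨m, rfl⟩ := Nat.exists_eq_add_of_le' hm
  have h1 := aser_mul m
  have h2 := aser_mul (3 * m + 2)
  rw [show 3 * m + 2 + 1 = 3 * (m + 1) by ring] at h2
  have hx : (X : K3⟦X⟧) ^ (3 * (m + 1)) = (X ^ (m + 1)) ^ 3 := by rw [← pow_mul, mul_comm]
  rw [rs, rs]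
  rw [hx] at h2 ⊢
  have h0 := three_zero
  generalize (X : K3⟦X⟧) ^ (m + 1) = x at *
  generalize aser (m + 1) = c at *
  generalize aser (3 * (m + 1)) = d at *
  have e1 : (1 + x ^ 3) * c ^ 3 = 1 := by
    linear_combination (((1 + x) * c) ^ 2 + (1 + x) * c + 1) * h1 - (x + x ^ 2) * c ^ 3 * h0
  have e2 : c ^ 3 = d := by
    linear_combination (-c ^ 3) * h2 + d * e1
  rw [mul_pow, e2]
  linear_combination d * (x ^ 2 - x) * h0

theorem prod_shift {A : Type*} [CommMonoid A] (f : ℕ → A) (M : ℕ) :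
    ∏ i ∈ range M, f (i + 1) = ∏ m ∈ Ico 1 (M + 1), f m := by
  rw [prod_Ico_eq_prod_range]
  simp [add_comm]

theorem key_identity (l M : ℕ) (hl : Nat.Coprime l 3) :
    ∃ E W : K3⟦X⟧, X ^ (M + 1) ∣ E - 1 ∧ SuppOn l W ∧
      (∏ i ∈ range M, if (¬ l ∣ (i + 1) ∧ ¬ 3 ∣ (i + 1)) then
        ((1 + X ^ (i + 1)) * bser K3 (i + 1) : K3⟦X⟧) else 1) * E = gU X aser M ^ 2 * W ^ 2 := by
  have hG := prod_shift (fun m => if (¬ l ∣ m ∧ ¬ 3 ∣ m) then rv m else 1) M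
  have hU : gU X aser M = ∏ m ∈ Ico 1 (M + 1), rs m := prod_shift rs M
  change (∏ i ∈ range M, if (¬ l ∣ (i + 1) ∧ ¬ 3 ∣ (i + 1)) then
        ((1 + X ^ (i + 1)) * bser K3 (i + 1) : K3⟦X⟧) else 1) = _ at hG
  rw [hG, hU]
  refine ⟨∏ m ∈ Ico 1 (M + 1), if ¬ l ∣ m ∧ M < 3 * m then rs (3 * m) else 1,
    ∏ m ∈ Ico 1 (M + 1), if l ∣ m then rv m else 1, ?_, ?_, ?_⟩
  · apply Finset.prod_induction _ (fun f => X ^ (M + 1) ∣ f - 1)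
    · rintro f g ⟨u, hu⟩ ⟨v, hv⟩
      exact ⟨u * g + v, by linear_combination g * hu + hv⟩
    · simp
    · intro m hm
      split_ifs with h
      · obtain ⟨t, rfl⟩ := Nat.exists_eq_add_of_le' (mem_Ico.1 hm).1
        have h1 := aser_mul (3 * t + 2)
        rw [show 3 * t + 2 + 1 = 3 * (t + 1) by ring] at h1
        rw [rs]
        apply (pow_dvd_pow X (show M + 1 ≤ 3 * (t + 1) by omega)).trans
        exact ⟨-2 * aser (3 * (t + 1)), by linear_combination h1⟩
      · simp
  · apply Finset.prod_induction _ (fun f => SuppOn l f)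
    · intro f g; exact SuppOn.mul
    · exact SuppOn.one
    · intro m hm
      split_ifs with h
      · exact SuppOn.rv (by have := (mem_Ico.1 hm).1; omega) h
      · exact SuppOn.one
  · set G := ∏ m ∈ Ico 1 (M + 1), if (¬ l ∣ m ∧ ¬ 3 ∣ m) then rv m else 1
    set E := ∏ m ∈ Ico 1 (M + 1), if ¬ l ∣ m ∧ M < 3 * m then rs (3 * m) else 1
    set W := ∏ m ∈ Ico 1 (M + 1), if l ∣ m then rv m else 1
    set U := ∏ m ∈ Ico 1 (M + 1), rs m
    set A := ∏ m ∈ Ico 1 (M + 1), if ¬ l ∣ m then rs m else 1 with hA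
    set B := ∏ m ∈ Ico 1 (M + 1), if ¬ l ∣ m then rv m else 1
    set A3 := ∏ m ∈ Ico 1 (M + 1), if ¬ l ∣ m ∧ 3 ∣ m then rs m else 1 with hA3
    have hAB : A * B = 1 := by
      rw [← prod_mul_distrib]
      apply prod_eq_one
      intro m hm
      have := rs_rv (mem_Ico.1 hm).1
      split_ifs <;> simp [this]
    have hUW : U * W = A := by
      rw [← prod_mul_distrib]
      apply prod_congr rfl
      intro m hm
      have := rs_rv (mem_Ico.1 hm).1
      split_ifs <;> simp_all
    have hGA : G * A = A3 := by
      rw [← prod_mul_distrib]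
      apply prod_congr rfl
      intro m hm
      have := rs_rv (mem_Ico.1 hm).1
      rw [mul_comm] at this
      by_cases h1 : l ∣ m <;> by_cases h2 : 3 ∣ m <;> simp [h1, h2, this]
    have hA3' : A3 = ∏ m ∈ Ico 1 (M + 1), if ¬ l ∣ m ∧ 3 * m ≤ M then rs (3 * m) else 1 := by
      rw [hA3, ← prod_filter, ← prod_filter]
      symm
      apply prod_nbij' (fun m => 3 * m) (fun m => m / 3)
      · intro m hm
        simp only [mem_filter, mem_Ico] at hm ⊢
        refine ⟨by omega, fun h => hm.2.1 (hl.dvd_of_dvd_mul_left h), by simp⟩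
      · intro m hm
        simp only [mem_filter, mem_Ico] at hm ⊢
        obtain ⟨h1, h2, t, rfl⟩ := hm
        rw [Nat.mul_div_cancel_left _ (by norm_num)]
        exact ⟨by omega, fun h => h2 (h.mul_left 3), by omega⟩
      · intro m hm
        simp
      · intro m hm
        simp only [mem_filter, mem_Ico] at hm
        exact Nat.mul_div_cancel' hm.2.2
      · intro m hm
        rfl
    have hcube : A ^ 3 = A3 * E := by
      rw [hA3', hA, ← prod_pow, ← prod_mul_distrib]
      apply prod_congr rfl
      intro m hm
      have := rs_cube (mem_Ico.1 hm).1
      by_cases h1 : l ∣ m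
      · simp [h1]
      · by_cases h2 : 3 * m ≤ M
        · simp [h1, h2, this, Nat.not_lt.2 h2]
        · simp [h1, h2, this, Nat.not_le.1 h2]
    have : G * E = A ^ 2 := by
      linear_combination (A ^ 2 - G * E) * hAB + B * E * hGA - B * hcube
    rw [this, ← hUW, mul_pow]

theorem three_dvd_count (n k α : ℕ) (hα : 2 * k + 1 < α) :
    3 ∣ biregularOverpartitions (2 ^ α) 3 (4 ^ k * (4 * n + 3)) := by
  rw [← ZMod.natCast_eq_zero_iff]
  obtain ⟨M, hM, h⟩ := count_eventually K3 (2 ^ α) 3 (4 ^ k * (4 * n + 3))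
  obtain ⟨E, W, ⟨e, hE⟩, hW, hG⟩ := key_identity (2 ^ α) M (Nat.Coprime.pow_left _ (by norm_num))
  obtain ⟨d, hd⟩ := gauss_dvd (X : K3⟦X⟧) aser (bser K3) aser_mul bser_mul M
  rw [h]
  set N := 4 ^ k * (4 * n + 3) with hN
  set G := ∏ i ∈ range M, if (¬ (2 ^ α) ∣ (i + 1) ∧ ¬ 3 ∣ (i + 1)) then
        ((1 + X ^ (i + 1)) * bser K3 (i + 1) : K3⟦X⟧) else 1
  have hGG : G = gS X M ^ 2 * W ^ 2 + X ^ (M + 1) *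
      (- G * e - d * (gS X M + gU X aser M) * W ^ 2) := by
    linear_combination hG - G * hE - (gS X M + gU X aser M) * W ^ 2 * hd
  rw [hGG, map_add, coeff_X_pow_mul', if_neg (by omega), add_zero, coeff_mul]
  apply sum_eq_zero
  rintro ⟨i, j⟩ hij
  rw [HasAntidiagonal.mem_antidiagonal] at hij
  simp only at hij ⊢
  by_contra hne
  have h1 := left_ne_zero_of_mul hne
  have h2 := right_ne_zero_of_mul hne
  rw [sq] at h2
  have hj := (hW.mul hW) j h2
  rw [sq, coeff_mul] at h1
  obtain ⟨⟨u, v⟩, huv, h3⟩ := exists_ne_zero_of_sum_ne_zero h1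
  rw [HasAntidiagonal.mem_antidiagonal] at huv
  obtain ⟨x, hx⟩ := coeff_gS _ _ (left_ne_zero_of_mul h3)
  obtain ⟨y, hy⟩ := coeff_gS _ _ (right_ne_zero_of_mul h3)
  simp only at hx hy huv
  have h4 : 4 ^ (k + 1) ∣ j := by
    refine dvd_trans ?_ hj
    rw [show 4 = 2 ^ 2 by norm_num, ← pow_mul]
    exact pow_dvd_pow _ (by omega)
  obtain ⟨t, rfl⟩ := h4
  have hpos : 0 < 4 ^ k := by positivity
  have hle : t ≤ n := by
    have : 4 ^ k * (4 * t) ≤ 4 ^ k * (4 * n + 3) := by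
      rw [← hN, ← hij, pow_succ]; nlinarith
    have := Nat.le_of_mul_le_mul_left this hpos
    omega
  obtain ⟨s, rfl⟩ := Nat.exists_eq_add_of_le hle
  apply not_two_sq k x y s
  rw [← hx, ← hy, huv]
  have : i + 4 ^ (k + 1) * t = 4 ^ k * (4 * s + 3) + 4 ^ (k + 1) * t := by
    rw [hij, hN]; ring
  omega

end Main

theorem biregular_overpartition_pow2_3_4k4n3_mod6 (n k α : ℕ) (hα : 2 * k + 1 < α) :
    6 ∣ biregularOverpartitions (2 ^ α) 3 (4 ^ k * (4 * n + 3)) := by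
  have h2 := two_dvd_count (2 ^ α) 3 (4 ^ k * (4 * n + 3)) (by positivity)
  have h3 := three_dvd_count n k α hα
  omega
end

section
/- For every integer n ≥ 0 and every integer α > 2, the number of (2^α, 3)-biregular overpartitions of 8n+7 is divisible by 12, i.e. B̄_{2^α,3}(8n+7) ≡ 0 (mod 12). -/
section geodef
open PowerSeries
/-- The geometric series `1/(1-X^k)`. -/
noncomputable def geo (R : Type) [CommRing R] (k : ℕ) : R⟦X⟧ :=
  PowerSeries.mk fun m => if k ∣ m then 1 else 0
end geodef

section counting
open PowerSeries

lemma geo_mul (R : Type) [CommRing R] (k : ℕ) (hk : 0 < k) :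
    (1 - X ^ k) * geo R k = 1 := by
  ext n
  rw [sub_mul, one_mul, map_sub, coeff_X_pow_mul', coeff_one]
  simp only [geo, coeff_mk]
  by_cases h : k ≤ n
  · have h0 : n ≠ 0 := by omega
    have : k ∣ n - k ↔ k ∣ n := by
      constructor
      · intro h1
        have := Nat.dvd_add h1 (dvd_refl k)
        rwa [Nat.sub_add_cancel h] at this
      · intro h1; exact Nat.dvd_sub h1 (dvd_refl k)
    simp [h, h0, this]
  · by_cases h0 : n = 0
    · subst h0; simp; omega
    · have : ¬ k ∣ n := fun h1 => h (Nat.le_of_dvd (by omega) h1)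
      simp [h, h0, this]

/-- Pairs of multisets with parts in `S`, `T`. -/
def prs (S T : Finset ℕ) (n : ℕ) : Set (Multiset ℕ × Multiset ℕ) :=
  {p | (∀ x ∈ p.1, x ∈ S) ∧ (∀ x ∈ p.2, x ∈ T) ∧ p.2.Nodup ∧ p.1.sum + p.2.sum = n}

lemma fin_ms (S : Finset ℕ) (hS : 0 ∉ S) (n : ℕ) :
    {s : Multiset ℕ | (∀ x ∈ s, x ∈ S) ∧ s.sum ≤ n}.Finite := by
  have : {s : Multiset ℕ | (∀ x ∈ s, x ∈ S) ∧ s.sum ≤ n} ⊆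
      ⋃ a ∈ Set.Iic n, Set.range (fun p : Nat.Partition a => p.parts) := by
    rintro s ⟨h1, h2⟩
    simp only [Set.mem_iUnion]
    refine ⟨s.sum, h2, ⟨s, ?_, rfl⟩, rfl⟩
    intro i hi
    rcases Nat.eq_zero_or_pos i with h | h
    · subst h; exact absurd (h1 _ hi) hS
    · exact h
  refine Set.Finite.subset ?_ this
  exact (Set.finite_Iic n).biUnion fun a _ => Set.finite_range _

lemma fin_prs (S T : Finset ℕ) (hS : 0 ∉ S) (hT : 0 ∉ T) (n : ℕ) : (prs S T n).Finite := by
  refine ((fin_ms S hS n).prod (fin_ms T hT n)).subset ?_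
  rintro ⟨a, b⟩ ⟨h1, h2, h3, h4⟩
  simp only at h1 h2 h3 h4
  exact ⟨⟨h1, by simp only; omega⟩, ⟨h2, by simp only; omega⟩⟩

lemma prs_ins_left (S T : Finset ℕ) (k : ℕ) (hk : k ∉ S) (hk0 : 0 < k)
    (hS : 0 ∉ S) (hT : 0 ∉ T) (n : ℕ) :
    (prs (insert k S) T n).ncard =
      (prs S T n).ncard + if k ≤ n then (prs (insert k S) T (n - k)).ncard else 0 := by
  have hS' : 0 ∉ insert k S := by simp [hS]; omega
  have key : prs (insert k S) T n = prs S T n ∪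
      (if k ≤ n then (fun p : Multiset ℕ × Multiset ℕ => (k ::ₘ p.1, p.2)) ''
        prs (insert k S) T (n - k) else ∅) := by
    ext ⟨a, b⟩
    constructor
    · rintro ⟨h1, h2, h3, h4⟩
      simp only at h1 h2 h3 h4
      by_cases hka : k ∈ a
      · right
        obtain ⟨a', rfl⟩ := Multiset.exists_cons_of_mem hka
        rw [Multiset.sum_cons] at h4
        rw [if_pos (by omega)]
        refine ⟨(a', b), ⟨fun x hx => h1 x (Multiset.mem_cons_of_mem hx), h2, h3, ?_⟩, rfl⟩
        simp only; omega
      · left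
        refine ⟨fun x hx => ?_, h2, h3, h4⟩
        rcases Finset.mem_insert.1 (h1 x hx) with h | h
        · subst h; exact absurd hx hka
        · exact h
    · rintro (⟨h1, h2, h3, h4⟩ | h)
      · exact ⟨fun x hx => Finset.mem_insert_of_mem (h1 x hx), h2, h3, h4⟩
      · split_ifs at h with hkn
        · obtain ⟨⟨a', b'⟩, ⟨h1, h2, h3, h4⟩, h5⟩ := h
          simp only [Prod.mk.injEq] at h1 h2 h3 h4 h5
          obtain ⟨rfl, rfl⟩ := h5
          refine ⟨fun x hx => ?_, h2, h3, ?_⟩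
          · rcases Multiset.mem_cons.1 hx with h | h
            · subst h; simp
            · exact h1 x h
          · simp only [Multiset.sum_cons]; omega
        · exact absurd h (by simp)
  rw [key, Set.ncard_union_eq ?_ (fin_prs S T hS hT n) ?_]
  · congr 1
    split_ifs with h
    · apply Set.ncard_image_of_injective
      rintro ⟨a, b⟩ ⟨c, d⟩ h
      simpa using h
    · simp
  · rw [Set.disjoint_left]
    rintro ⟨a, b⟩ ⟨h1, -⟩ h
    split_ifs at h with hkn
    · obtain ⟨⟨a', b'⟩, -, h5⟩ := h
      simp only [Prod.mk.injEq] at h5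
      exact hk (h1 k (by simp [← h5.1]))
    · exact absurd h (by simp)
  · split_ifs with h
    · exact ((fin_prs _ T hS' hT (n - k)).image _)
    · simp

lemma prs_ins_right (S T : Finset ℕ) (k : ℕ) (hk : k ∉ T)
    (hS : 0 ∉ S) (hT : 0 ∉ T) (n : ℕ) :
    (prs S (insert k T) n).ncard =
      (prs S T n).ncard + if k ≤ n then (prs S T (n - k)).ncard else 0 := by
  have key : prs S (insert k T) n = prs S T n ∪
      (if k ≤ n then (fun p : Multiset ℕ × Multiset ℕ => (p.1, k ::ₘ p.2)) ''
        prs S T (n - k) else ∅) := by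
    ext ⟨a, b⟩
    constructor
    · rintro ⟨h1, h2, h3, h4⟩
      simp only at h1 h2 h3 h4
      by_cases hka : k ∈ b
      · right
        obtain ⟨b', rfl⟩ := Multiset.exists_cons_of_mem hka
        rw [Multiset.sum_cons] at h4
        rw [if_pos (by omega)]
        rw [Multiset.nodup_cons] at h3
        refine ⟨(a, b'), ⟨h1, fun x hx => ?_, h3.2, ?_⟩, rfl⟩
        · rcases Finset.mem_insert.1 (h2 x (Multiset.mem_cons_of_mem hx)) with h | h
          · subst h; exact absurd hx h3.1
          · exact h
        · simp only; omega
      · left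
        refine ⟨h1, fun x hx => ?_, h3, h4⟩
        rcases Finset.mem_insert.1 (h2 x hx) with h | h
        · subst h; exact absurd hx hka
        · exact h
    · rintro (⟨h1, h2, h3, h4⟩ | h)
      · exact ⟨h1, fun x hx => Finset.mem_insert_of_mem (h2 x hx), h3, h4⟩
      · split_ifs at h with hkn
        · obtain ⟨⟨a', b'⟩, ⟨h1, h2, h3, h4⟩, h5⟩ := h
          simp only [Prod.mk.injEq] at h1 h2 h3 h4 h5
          obtain ⟨rfl, rfl⟩ := h5
          refine ⟨h1, fun x hx => ?_, ?_, ?_⟩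
          · rcases Multiset.mem_cons.1 hx with h | h
            · subst h; simp
            · exact Finset.mem_insert_of_mem (h2 x h)
          · exact Multiset.nodup_cons.2 ⟨fun h => hk (h2 k h), h3⟩
          · simp only [Multiset.sum_cons]; omega
        · exact absurd h (by simp)
  rw [key, Set.ncard_union_eq ?_ (fin_prs S T hS hT n) ?_]
  · congr 1
    split_ifs with h
    · apply Set.ncard_image_of_injective
      rintro ⟨a, b⟩ ⟨c, d⟩ h
      simpa using h
    · simp
  · rw [Set.disjoint_left]
    rintro ⟨a, b⟩ ⟨-, h1, -⟩ h
    split_ifs at h with hkn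
    · obtain ⟨⟨a', b'⟩, -, h5⟩ := h
      simp only [Prod.mk.injEq] at h5
      exact hk (h1 k (by simp [← h5.2]))
    · exact absurd h (by simp)
  · split_ifs with h
    · exact ((fin_prs _ T hS hT (n - k)).image _)
    · simp

lemma prs_gen (R : Type) [CommRing R] (S T : Finset ℕ) (hS : 0 ∉ S) (hT : 0 ∉ T) :
    (PowerSeries.mk fun n => ((prs S T n).ncard : R)) =
      (∏ k ∈ S, geo R k) * ∏ k ∈ T, (1 + X ^ k) := by
  induction S using Finset.induction_on with
  | empty =>
    induction T using Finset.induction_on with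
    | empty =>
      ext n
      simp only [Finset.prod_empty, mul_one, coeff_mk, coeff_one]
      have : prs ∅ ∅ n = if n = 0 then {(0, 0)} else ∅ := by
        ext ⟨a, b⟩
        constructor
        · rintro ⟨h1, h2, h3, h4⟩
          have ha : a = 0 := Multiset.eq_zero_of_forall_notMem fun x hx => by simpa using h1 x hx
          have hb : b = 0 := Multiset.eq_zero_of_forall_notMem fun x hx => by simpa using h2 x hx
          subst ha hb
          simp at h4
          simp [← h4]
        · intro h
          split_ifs at h with hn
          · simp only [Set.mem_singleton_iff, Prod.mk.injEq] at h
            obtain ⟨rfl, rfl⟩ := h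
            simp [prs, hn]
          · exact absurd h (by simp)
      rw [this]
      split_ifs <;> simp
    | insert k T hk ih =>
      have hT' : 0 ∉ T := fun h => hT (Finset.mem_insert_of_mem h)
      rw [Finset.prod_insert hk, mul_left_comm, ← ih hT']
      ext n
      rw [add_mul, one_mul, map_add, coeff_X_pow_mul']
      simp only [coeff_mk]
      rw [prs_ins_right ∅ T k hk hS hT' n]
      push_cast
      rfl
  | insert k S hk ih =>
    have hS' : 0 ∉ S := fun h => hS (Finset.mem_insert_of_mem h)
    have hk0 : 0 < k := Nat.pos_of_ne_zero fun h => hS (by simp [h])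
    have h1 : (1 - X ^ k) * (PowerSeries.mk fun n => ((prs (insert k S) T n).ncard : R)) =
        (PowerSeries.mk fun n => ((prs S T n).ncard : R)) := by
      ext n
      rw [sub_mul, one_mul, map_sub, coeff_X_pow_mul']
      simp only [coeff_mk]
      rw [prs_ins_left S T k hk hk0 hS' hT n]
      push_cast
      simp
    rw [Finset.prod_insert hk, mul_assoc, ← ih hS', ← h1, ← mul_assoc, mul_comm (geo R k),
      geo_mul R k hk0, one_mul]

/-- allowed parts up to `M` -/
def allowed (l M : ℕ) : Finset ℕ := {k ∈ Finset.Icc 1 M | ¬ l ∣ k ∧ ¬ 3 ∣ k}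

lemma count_eq_s4 (R : Type) [CommRing R] (l M N : ℕ) (h : N ≤ M) :
    (biregularOverpartitions l 3 N : R) =
      coeff N (∏ k ∈ allowed l M, ((1 + X ^ k) * geo R k)) := by
  have h0 : 0 ∉ allowed l M := by simp [allowed]
  rw [Finset.prod_mul_distrib, mul_comm, ← prs_gen R _ _ h0 h0, coeff_mk]
  congr 1
  unfold biregularOverpartitions
  congr 1
  ext ⟨a, b⟩
  simp only [prs, allowed, Set.mem_setOf_eq, Finset.mem_filter, Finset.mem_Icc]
  constructor
  · rintro ⟨h1, h2, h3, h4⟩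
    refine ⟨fun x hx => ⟨⟨(h1 x hx).1, ?_⟩, (h1 x hx).2⟩,
      fun x hx => ⟨⟨(h2 x hx).1, ?_⟩, (h2 x hx).2⟩, h3, h4⟩
    · have := Multiset.le_sum_of_mem hx; omega
    · have := Multiset.le_sum_of_mem hx; omega
  · rintro ⟨h1, h2, h3, h4⟩
    exact ⟨fun x hx => ⟨(h1 x hx).1.1, (h1 x hx).2⟩, fun x hx => ⟨(h2 x hx).1.1, (h2 x hx).2⟩,
      h3, h4⟩

end counting

section mod4
open PowerSeries

lemma geo4 (k : ℕ) (hk : 0 < k) : (1 + X ^ k) * geo (ZMod 4) k =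
    1 + 2 * PowerSeries.mk (fun m => if k ∣ m ∧ m ≠ 0 then (1 : ZMod 4) else 0) := by
  have h1 := geo_mul (ZMod 4) k hk
  have h2 : geo (ZMod 4) k = 1 + 
      PowerSeries.mk (fun m => if k ∣ m ∧ m ≠ 0 then (1 : ZMod 4) else 0) := by
    ext n
    simp only [geo, coeff_mk, map_add, coeff_one]
    by_cases h : n = 0 <;> simp [h]
  have h3 : (1 + X ^ k) * geo (ZMod 4) k = 2 * geo (ZMod 4) k - 1 := by
    linear_combination -h1
  rw [h3, h2]; ring

lemma prod4 {A : Type} [CommRing A] (h4 : (4 : A) = 0) (e : ℕ → A) (S : Finset ℕ) :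
    ∏ k ∈ S, (1 + 2 * e k) = 1 + 2 * ∑ k ∈ S, e k := by
  induction S using Finset.induction_on with
  | empty => simp
  | insert k S hk ih =>
    rw [Finset.prod_insert hk, Finset.sum_insert hk, ih]
    linear_combination (e k * ∑ k ∈ S, e k) * h4

lemma even_divs (n l M : ℕ) (hl : 8 ∣ l) (hM : 8 * n + 7 ≤ M) :
    Even ({k ∈ allowed l M | k ∣ 8 * n + 7}).card := by
  set N := 8 * n + 7 with hN
  obtain ⟨a, m, hm3, hNm⟩ := Nat.exists_eq_pow_mul_and_not_dvd (n := N) (by omega) 3 (by norm_num)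
  have hm0 : 0 < m := Nat.pos_of_ne_zero (by rintro rfl; simp at hm3)
  have hset : {k ∈ allowed l M | k ∣ N} = m.divisors := by
    ext k
    simp only [allowed, Finset.mem_filter, Finset.mem_Icc, Nat.mem_divisors]
    constructor
    · rintro ⟨⟨_, _, h3⟩, hk⟩
      refine ⟨?_, hm0.ne'⟩
      rw [hNm] at hk
      refine Nat.Coprime.dvd_of_dvd_mul_left ?_ hk
      exact Nat.Coprime.pow_right a ((Nat.Prime.coprime_iff_not_dvd Nat.prime_three).2 h3).symm
    · rintro ⟨hk, _⟩
      have hkN : k ∣ N := hNm ▸ hk.mul_left _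
      refine ⟨⟨⟨Nat.pos_of_dvd_of_pos hk hm0, (Nat.le_of_dvd (by omega) hkN).trans hM⟩, ?_, ?_⟩, hkN⟩
      · intro h
        have : 8 ∣ N := (hl.trans h).trans hkN
        omega
      · intro h; exact hm3 (h.trans hk)
  rw [hset]
  have hz : ((m.divisors.card : ℕ) : ZMod 2) = 0 := by
    rw [Finset.card_eq_sum_ones, Nat.cast_sum]
    refine Finset.sum_involution (fun d _ => m / d) ?_ ?_ ?_ ?_
    · intro d _; decide
    · intro d hd _ heq
      have hd' := (Nat.mem_divisors.1 hd).1
      have h1 : d * d = m := by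
        have := Nat.div_mul_cancel hd'
        rwa [heq] at this
      rw [← h1] at hNm
      have h2 : (3 ^ a) % 8 = 1 ∨ (3 ^ a) % 8 = 3 := by
        clear hNm
        induction a with
        | zero => simp
        | succ a ih => rw [pow_succ]; omega
      have h3 : N % 8 = 7 := by omega
      rw [hNm, Nat.mul_mod, Nat.mul_mod d d] at h3
      have h4 : d % 8 < 8 := Nat.mod_lt _ (by norm_num)
      generalize d % 8 = r at *
      rcases h2 with h2 | h2 <;> rw [h2] at h3 <;> interval_cases r <;> simp at h3
    · intro d hd
      exact Nat.mem_divisors.2 ⟨Nat.div_dvd_of_dvd (Nat.mem_divisors.1 hd).1, hm0.ne'⟩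
    · intro d hd
      exact Nat.div_div_self (Nat.mem_divisors.1 hd).1 hm0.ne'
  exact (ZMod.natCast_eq_zero_iff_even).1 hz

lemma main4 (n l : ℕ) (hl : 8 ∣ l) : 4 ∣ biregularOverpartitions l 3 (8 * n + 7) := by
  rw [← ZMod.natCast_eq_zero_iff, count_eq_s4 (ZMod 4) l _ _ le_rfl]
  rw [Finset.prod_congr rfl fun k hk => geo4 k (by simp [allowed] at hk; omega)]
  rw [prod4]
  · rw [map_add, coeff_one, if_neg (by omega), zero_add]
    have : (2 : (ZMod 4)⟦X⟧) = C 2 := (map_ofNat C 2).symm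
    rw [this, coeff_C_mul, map_sum]
    simp only [coeff_mk]
    have h7 : 8 * n + 7 ≠ 0 := by omega
    simp only [h7, ne_eq, not_false_eq_true, and_true]
    rw [← Finset.sum_filter, Finset.sum_const]
    obtain ⟨r, hr⟩ := even_divs n l _ hl le_rfl
    rw [hr, nsmul_eq_mul, mul_one]
    push_cast
    have h40 : (4 : ZMod 4) = 0 := by decide
    linear_combination (r : ZMod 4) * h40
  · have : (4 : (ZMod 4)⟦X⟧) = C 4 := (map_ofNat C 4).symm
    rw [this, show (4 : ZMod 4) = 0 by decide, map_zero]

end mod4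

section mod3
open PowerSeries

/-- Shanks-type finite identity. -/
lemma shanks {A : Type} [CommRing A] (q : A) (i : ℕ → A) (hi : ∀ k, i k * (1 + q ^ k) = 1) (n : ℕ) :
    (2 * i 0) * 1 + 2 * ∑ s ∈ Finset.range n, (-1) ^ (s + 1) * q ^ ((s + 1) ^ 2) =
    ∑ s ∈ Finset.range (n + 1), (-1) ^ s * 2 * (∏ k ∈ Finset.Ioc s n, ((1 - q ^ k) * i k)) *
      q ^ (s * (n + 1)) * i s := by
  induction n with
  | zero => simp
  | succ n ih =>
    have tel : ∀ m, m ≤ n → ∑ s ∈ Finset.range (m + 1),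
        ((-1) ^ s * 2 * (∏ k ∈ Finset.Ioc s (n + 1), ((1 - q ^ k) * i k)) *
          q ^ (s * (n + 1 + 1)) * i s -
        (-1) ^ s * 2 * (∏ k ∈ Finset.Ioc s n, ((1 - q ^ k) * i k)) *
          q ^ (s * (n + 1)) * i s) =
        (-1) ^ (m + 1) * 2 * i (n + 1) * (∏ k ∈ Finset.Ioc m n, ((1 - q ^ k) * i k)) *
          q ^ ((m + 1) * (n + 1)) := by
      intro m
      induction m with
      | zero =>
        intro _
        rw [Finset.sum_range_one, Finset.prod_Ioc_succ_top (by omega)]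
        have h0 := hi 0
        have h1 := hi (n + 1)
        set P := ∏ k ∈ Finset.Ioc 0 n, ((1 - q ^ k) * i k)
        simp only [pow_zero, zero_mul, one_mul, mul_one, zero_add, pow_one] at *
        generalize i (n + 1) = j at *
        generalize q ^ (n + 1) = x at *
        linear_combination (-2 * P * j * x) * h0 + (2 * P * i 0) * h1
      | succ m ihm =>
        intro hm
        rw [Finset.sum_range_succ, ihm (by omega), Finset.prod_Ioc_succ_top (by omega)]
        have hP : ∏ k ∈ Finset.Ioc m n, ((1 - q ^ k) * i k) = ((1 - q ^ (m + 1)) * i (m + 1)) *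
            ∏ k ∈ Finset.Ioc (m + 1) n, ((1 - q ^ k) * i k) := by
          rw [← Finset.prod_Ioc_consecutive _ (show m ≤ m + 1 by omega) hm]
          simp
        rw [hP]
        have h0 := hi (m + 1)
        have h1 := hi (n + 1)
        set P := ∏ k ∈ Finset.Ioc (m + 1) n, ((1 - q ^ k) * i k)
        have e1 : q ^ ((m + 1) * (n + 1 + 1)) = q ^ ((m + 1) * (n + 1)) * q ^ (m + 1) := by ring
        have e2 : q ^ ((m + 1 + 1) * (n + 1)) = q ^ ((m + 1) * (n + 1)) * q ^ (n + 1) := by ring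
        rw [e1, e2, pow_succ (-1 : A) (m + 1)]
        generalize q ^ ((m + 1) * (n + 1)) = z at *
        generalize i (n + 1) = j at *
        generalize q ^ (n + 1) = x at *
        generalize i (m + 1) = u at *
        generalize q ^ (m + 1) = y at *
        generalize (-1 : A) ^ (m + 1) = e at *
        linear_combination (-2 * e * P * j * x * z) * h0 + (2 * e * P * u * z) * h1
    have := tel n le_rfl
    rw [Finset.sum_sub_distrib, ← ih] at this
    rw [Finset.sum_range_succ _ (n + 1), Finset.sum_range_succ _ n]
    have h1 := hi (n + 1)
    rw [Finset.Ioc_self, Finset.prod_empty, mul_one] at this ⊢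
    have e1 : q ^ ((n + 1) * (n + 1 + 1)) = q ^ ((n + 1) ^ 2) * q ^ (n + 1) := by ring
    have e2 : q ^ ((n + 1) * (n + 1)) = q ^ ((n + 1) ^ 2) := by ring
    rw [e2] at this
    rw [e1]
    linear_combination (-1) * this - 2 * (-1) ^ (n + 1) * q ^ ((n + 1) ^ 2) * h1

instance : Fact (Nat.Prime 3) := ⟨Nat.prime_three⟩

/-- `1/(1+X^k)` -/
noncomputable def iv (k : ℕ) : (ZMod 3)⟦X⟧ := (1 + X ^ k)⁻¹

/-- `(1-X^k)/(1+X^k)` -/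
noncomputable def ff (k : ℕ) : (ZMod 3)⟦X⟧ := (1 - X ^ k) * iv k

lemma iv_mul (k : ℕ) : iv k * (1 + X ^ k) = 1 := by
  apply PowerSeries.inv_mul_cancel
  rcases Nat.eq_zero_or_pos k with h | h
  · subst h; simp; decide
  · simp [h.ne']

/-- supported on multiples of 8 -/
def P8 (a : (ZMod 3)⟦X⟧) : Prop := ∀ m, ¬ 8 ∣ m → coeff m a = 0

lemma P8_one : P8 1 := by
  intro m hm
  rw [coeff_one, if_neg]
  rintro rfl; simp at hm

lemma P8_mul {a b : (ZMod 3)⟦X⟧} (ha : P8 a) (hb : P8 b) : P8 (a * b) := by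
  intro m hm
  rw [coeff_mul]
  apply Finset.sum_eq_zero
  rintro ⟨x, y⟩ hxy
  rw [Finset.HasAntidiagonal.mem_antidiagonal] at hxy
  simp only at hxy ⊢
  by_cases hx : 8 ∣ x
  · rw [hb y (by omega), mul_zero]
  · rw [ha x hx, zero_mul]

lemma P8_ff (k : ℕ) (hk : 0 < k) (h8 : 8 ∣ k) : P8 (ff k) := by
  have h1 := geo_mul (ZMod 3) (2 * k) (by omega)
  have h2 := iv_mul k
  have h3 : iv k = (1 - X ^ k) * geo (ZMod 3) (2 * k) := by
    have e : (X : (ZMod 3)⟦X⟧) ^ (2 * k) = X ^ k * X ^ k := by ring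
    rw [e] at h1
    linear_combination (-iv k) * h1 + ((1 - X ^ k) * geo (ZMod 3) (2 * k)) * h2
  have h4 : P8 (1 - X ^ k) := by
    intro m hm
    have hm0 : m ≠ 0 := by rintro rfl; simp at hm
    have hmk : m ≠ k := by rintro rfl; exact hm h8
    rw [map_sub, coeff_one, coeff_X_pow, if_neg hm0, if_neg hmk, sub_zero]
  have h5 : P8 (geo (ZMod 3) (2 * k)) := by
    intro m hm
    simp only [geo, coeff_mk]
    rw [if_neg]
    intro h
    exact hm (h8.trans ((Dvd.intro_left 2 rfl).trans h))
  rw [ff, h3]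
  exact P8_mul h4 (P8_mul h4 h5)

lemma P8_prod (S : Finset ℕ) (h : ∀ k ∈ S, 0 < k ∧ 8 ∣ k) : P8 (∏ k ∈ S, ff k) := by
  induction S using Finset.induction_on with
  | empty => simpa using P8_one
  | insert k S hk ih =>
    rw [Finset.prod_insert hk]
    have := h k (Finset.mem_insert_self _ _)
    exact P8_mul (P8_ff k this.1 this.2) (ih fun j hj => h j (Finset.mem_insert_of_mem hj))

lemma P8_shift {E : (ZMod 3)⟦X⟧} (hE : P8 E) (n s t : ℕ) :
    coeff (8 * n + 7) (X ^ (s ^ 2) * X ^ (t ^ 2) * E) = 0 := by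
  rw [← pow_add, coeff_X_pow_mul']
  split_ifs with h
  · apply hE
    intro hd
    have h3 : (s ^ 2 + t ^ 2) % 8 = 7 := by omega
    have h1 : s ^ 2 % 8 = 0 ∨ s ^ 2 % 8 = 1 ∨ s ^ 2 % 8 = 4 := by
      rw [Nat.pow_mod]
      have h4 : s % 8 < 8 := Nat.mod_lt _ (by norm_num)
      generalize s % 8 = r at *
      interval_cases r <;> simp
    have h2 : t ^ 2 % 8 = 0 ∨ t ^ 2 % 8 = 1 ∨ t ^ 2 % 8 = 4 := by
      rw [Nat.pow_mod]
      have h4 : t % 8 < 8 := Nat.mod_lt _ (by norm_num)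
      generalize t % 8 = r at *
      interval_cases r <;> simp
    omega
  · rfl

/-- Product up to `L`. -/
noncomputable def Ph (L : ℕ) : (ZMod 3)⟦X⟧ := ∏ k ∈ Finset.Ioc 0 L, ff k

lemma theta (L : ℕ) : ∃ c : ℕ → ZMod 3, X ^ (L + 1) ∣
    (∑ s ∈ Finset.range (L + 1), C (c s) * X ^ (s ^ 2)) - Ph L := by
  have h := shanks (X : (ZMod 3)⟦X⟧) iv iv_mul L
  have h0 : 2 * iv 0 = 1 := by
    have := iv_mul 0
    rw [pow_zero] at this
    linear_combination this
  refine ⟨fun s => if s = 0 then 1 else 2 * (-1) ^ s, ?_⟩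
  have e : (∑ s ∈ Finset.range (L + 1), C (if s = 0 then (1 : ZMod 3) else 2 * (-1) ^ s) * X ^ (s ^ 2)) =
      (2 * iv 0) * 1 + 2 * ∑ s ∈ Finset.range L, (-1) ^ (s + 1) * X ^ ((s + 1) ^ 2) := by
    rw [Finset.sum_range_succ', h0, Finset.mul_sum]
    have h2 : (2 : (ZMod 3)⟦X⟧) = C 2 := (map_ofNat C 2).symm
    have hs : ∑ s ∈ Finset.range L, C (if s + 1 = 0 then (1 : ZMod 3) else 2 * (-1) ^ (s + 1)) *
        X ^ ((s + 1) ^ 2) = ∑ s ∈ Finset.range L,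
          (2 : (ZMod 3)⟦X⟧) * ((-1) ^ (s + 1) * X ^ ((s + 1) ^ 2)) := by
      refine Finset.sum_congr rfl fun s _ => ?_
      rw [h2]
      simp [mul_assoc]
    rw [hs]
    simp [add_comm]
  rw [e, h, Finset.sum_range_succ']
  have e2 : (-1) ^ 0 * 2 * (∏ k ∈ Finset.Ioc 0 L, ((1 - X ^ k) * iv k)) *
      X ^ (0 * (L + 1)) * iv 0 = Ph L := by
    have : Ph L = ∏ k ∈ Finset.Ioc 0 L, ((1 - X ^ k) * iv k) := rfl
    rw [this]
    simp only [pow_zero, one_mul, zero_mul, mul_one]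
    linear_combination (∏ k ∈ Finset.Ioc 0 L, ((1 - X ^ k) * iv k)) * h0
  rw [e2, add_sub_cancel_right]
  refine Finset.dvd_sum fun s _ => ?_
  refine Dvd.dvd.mul_right (Dvd.dvd.mul_left ?_ _) _
  exact pow_dvd_pow _ (by nlinarith)

lemma ff_cube (j : ℕ) : ff (3 * j) = ff j ^ 3 := by
  have h3 : (3 : (ZMod 3)⟦X⟧) = 0 := by
    have : (3 : (ZMod 3)⟦X⟧) = C 3 := (map_ofNat C 3).symm
    rw [this, show (3 : ZMod 3) = 0 by decide, map_zero]
  have h1 := iv_mul j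
  have h2 := iv_mul (3 * j)
  have e : (X : (ZMod 3)⟦X⟧) ^ (3 * j) = (X ^ j) ^ 3 := by ring
  rw [ff, ff, e]
  rw [e] at h2
  generalize (X : (ZMod 3)⟦X⟧) ^ j = x at *
  have h4 : (1 + x) ^ 3 = 1 + x ^ 3 := by linear_combination (x + x ^ 2) * h3
  have h5 : (1 - x) ^ 3 = 1 - x ^ 3 := by linear_combination (-x + x ^ 2) * h3
  have h6 : iv j ^ 3 * (1 + x ^ 3) = 1 := by
    rw [← h4, ← mul_pow, h1, one_pow]
  have h7 : iv (3 * j) = iv j ^ 3 := by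
    linear_combination (-iv (3 * j)) * h6 + (iv j ^ 3) * h2
  rw [mul_pow, h5, h7]

lemma ff_one_mod (k L : ℕ) (hk : L + 1 ≤ k) : X ^ (L + 1) ∣ ff k - 1 := by
  have h := iv_mul k
  have : ff k - 1 = X ^ k * (-2 * iv k) := by
    rw [ff]; linear_combination h
  rw [this]
  exact (pow_dvd_pow _ hk).mul_right _

lemma prod_one_mod (L : ℕ) (S : Finset ℕ) (h : ∀ k ∈ S, L + 1 ≤ k) :
    X ^ (L + 1) ∣ (∏ k ∈ S, ff k) - 1 := by
  induction S using Finset.induction_on with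
  | empty => simp
  | insert k S hk ih =>
    rw [Finset.prod_insert hk]
    have h1 := ff_one_mod k L (h k (Finset.mem_insert_self _ _))
    have h2 := ih fun j hj => h j (Finset.mem_insert_of_mem hj)
    have : ff k * (∏ k ∈ S, ff k) - 1 = (ff k - 1) * (∏ k ∈ S, ff k) + ((∏ k ∈ S, ff k) - 1) := by
      ring
    rw [this]
    exact dvd_add (h1.mul_right _) h2

lemma unit_ff (k : ℕ) (hk : 0 < k) : ((1 + X ^ k) * geo (ZMod 3) k) * ff k = 1 := by
  have h1 := geo_mul (ZMod 3) k hk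
  have h2 := iv_mul k
  rw [ff]
  linear_combination h1 + ((1 - X ^ k) * geo (ZMod 3) k) * h2

lemma main3 (n l : ℕ) (hl : 8 ∣ l) : 3 ∣ biregularOverpartitions l 3 (8 * n + 7) := by
  rw [← ZMod.natCast_eq_zero_iff, count_eq_s4 (ZMod 3) l (3 * (8 * n + 7)) _ (by omega)]
  set L := 8 * n + 7 with hL
  set G := ∏ k ∈ allowed l (3 * L), ((1 + X ^ k) * geo (ZMod 3) k) with hG
  have hG1 : G * ∏ k ∈ allowed l (3 * L), ff k = 1 := by
    rw [hG, ← Finset.prod_mul_distrib]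
    refine Finset.prod_eq_one fun k hk => unit_ff k ?_
    simp [allowed] at hk; omega
  set E := ∏ k ∈ (Finset.Ioc 0 (3 * L)).filter (fun k => ¬ 3 ∣ k ∧ l ∣ k), ff k with hE
  have hE8 : P8 E := by
    apply P8_prod
    intro k hk
    simp only [Finset.mem_filter, Finset.mem_Ioc] at hk
    exact ⟨hk.1.1, hl.trans hk.2.2⟩
  have h1 : Ph (3 * L) = (∏ k ∈ allowed l (3 * L), ff k) * E * Ph L ^ 3 := by
    have e1 : Ph L ^ 3 = ∏ k ∈ (Finset.Ioc 0 (3 * L)).filter (fun k => 3 ∣ k), ff k := by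
      rw [Ph, ← Finset.prod_pow, Finset.prod_congr rfl fun j _ => (ff_cube j).symm]
      refine Finset.prod_bij (fun j _ => 3 * j) ?_ ?_ ?_ ?_
      · intro j hj
        simp only [Finset.mem_filter, Finset.mem_Ioc] at hj ⊢
        omega
      · intro a _ b _ h; exact Nat.eq_of_mul_eq_mul_left (by norm_num) h
      · intro b hb
        simp only [Finset.mem_filter, Finset.mem_Ioc] at hb
        exact ⟨b / 3, Finset.mem_Ioc.2 (by omega), by omega⟩
      · intro _ _; rfl
    have e2 : (∏ k ∈ allowed l (3 * L), ff k) * E =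
        ∏ k ∈ (Finset.Ioc 0 (3 * L)).filter (fun k => ¬ 3 ∣ k), ff k := by
      rw [← Finset.prod_filter_mul_prod_filter_not
        ((Finset.Ioc 0 (3 * L)).filter (fun k => ¬ 3 ∣ k)) (fun k => ¬ l ∣ k)]
      congr 1
      · refine Finset.prod_congr ?_ fun _ _ => rfl
        ext k
        simp only [allowed, Finset.mem_filter, Finset.mem_Ioc, Finset.mem_Icc]
        constructor
        · rintro ⟨⟨h1, h2⟩, h3, h4⟩; exact ⟨⟨⟨h1, h2⟩, h4⟩, h3⟩
        · rintro ⟨⟨⟨h1, h2⟩, h4⟩, h3⟩; exact ⟨⟨h1, h2⟩, h3, h4⟩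
      · rw [hE]
        refine Finset.prod_congr ?_ fun _ _ => rfl
        ext k
        simp only [Finset.mem_filter, not_not, and_assoc]
    rw [e2, e1, mul_comm (Finset.prod _ _), Finset.prod_filter_mul_prod_filter_not]
    rfl
  set Q := ∏ k ∈ Finset.Ioc L (3 * L), ff k with hQ
  have h2 : Ph (3 * L) = Ph L * Q := by
    rw [Ph, Ph, hQ, Finset.prod_Ioc_consecutive _ (by omega) (by omega)]
  have hU : Ph L * ∏ k ∈ Finset.Ioc 0 L, ((1 + X ^ k) * geo (ZMod 3) k) = 1 := by
    rw [Ph, ← Finset.prod_mul_distrib]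
    refine Finset.prod_eq_one fun k hk => ?_
    rw [mul_comm]
    exact unit_ff k (Finset.mem_Ioc.1 hk).1
  have h3 : G * Q = E * Ph L ^ 2 := by
    set U := ∏ k ∈ Finset.Ioc 0 L, ((1 + X ^ k) * geo (ZMod 3) k)
    rw [h2] at h1
    linear_combination (-G * Q + E * Ph L ^ 2) * hU + (G * U) * h1 + (E * Ph L ^ 3 * U) * hG1
  have hQ1 : X ^ (L + 1) ∣ Q - 1 :=
    prod_one_mod L _ fun k hk => by rw [Finset.mem_Ioc] at hk; omega
  obtain ⟨c, hc⟩ := theta L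
  set th := ∑ s ∈ Finset.range (L + 1), C (c s) * X ^ (s ^ 2) with hth
  have hd : X ^ (L + 1) ∣ G - th * th * E := by
    have : G - th * th * E = (th - Ph L) * (-(th + Ph L) * E) + (Q - 1) * (-G) := by
      linear_combination h3
    rw [this]
    exact dvd_add (hc.mul_right _) (hQ1.mul_right _)
  have hco := (X_pow_dvd_iff.1 hd) L (by omega)
  rw [map_sub, sub_eq_zero] at hco
  rw [hco, hth, Finset.sum_mul_sum, Finset.sum_mul, map_sum]
  refine Finset.sum_eq_zero fun s _ => ?_
  rw [Finset.sum_mul, map_sum]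
  refine Finset.sum_eq_zero fun t _ => ?_
  have : C (c s) * X ^ (s ^ 2) * (C (c t) * X ^ (t ^ 2)) * E =
      C (c s * c t) * (X ^ (s ^ 2) * X ^ (t ^ 2) * E) := by
    rw [map_mul]; ring
  rw [this, coeff_C_mul, P8_shift hE8, mul_zero]

end mod3

theorem biregular_overpartition_pow2_3_8n7_mod12 (n α : ℕ) (hα : 2 < α) :
    12 ∣ biregularOverpartitions (2 ^ α) 3 (8 * n + 7) := by
  have hl : 8 ∣ 2 ^ α := by
    have h8 : (8 : ℕ) = 2 ^ 3 := by norm_num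
    rw [h8]
    exact pow_dvd_pow 2 (by omega)
  exact Nat.Coprime.mul_dvd_of_dvd_of_dvd (m := 4) (n := 3) (by norm_num) (main4 n _ hl) (main3 n _ hl)
end

section
/- Let n ≥ 0, β ≥ 2 and α ≥ 1 be integers, and let i ∈ {1, 2}. Then the number of (2^{2α}, 3^β)-biregular overpartitions of 9n+3i is divisible by 8, i.e. B̄_{2^{2α},3^β}(9n+3i) ≡ 0 (mod 8). -/
section helpers
open Finset

section gauss
variable {R : Type*} [CommRing R]

/-- auxiliary coefficient -/
def ovC (q : R) (s : ℕ) : R := (-1) ^ s * ∏ k ∈ range s, (1 + q ^ k)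
/-- auxiliary product -/
def ovU (q : R) (s n : ℕ) : R := ∏ k ∈ Ico s n, (1 - q ^ (k + 1))
/-- auxiliary terms -/
def ovT (q : R) (n s : ℕ) : R := ovC q s * ovU q s n * q ^ (s * (n + 1))

/-- theta tail -/
def ovS (q : R) (n : ℕ) : R := ∑ j ∈ range n, (-1) ^ (j + 1) * q ^ ((j + 1) ^ 2)

lemma ovC_succ (q : R) (s : ℕ) : ovC q (s + 1) = -(1 + q ^ s) * ovC q s := by
  simp only [ovC, prod_range_succ, pow_succ]; ring

lemma ovC_two (q : R) (n : ℕ) :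
    ovC q n * (1 + q ^ n) = (-1) ^ n * (2 * ∏ k ∈ range n, (1 + q ^ (k + 1))) := by
  have h := prod_range_succ (fun k => 1 + q ^ k) n
  rw [prod_range_succ'] at h
  simp only [ovC, mul_assoc, ← h, pow_zero]
  ring

lemma ov_tel (q : R) (n m : ℕ) (hm : m ≤ n) :
    ∑ s ∈ range m, (ovT q (n + 1) s - (1 + q ^ (n + 1)) * ovT q n s)
      = ovC q m * q ^ (m * (n + 1)) * (1 - q ^ m) * ovU q m n := by
  induction m with
  | zero => simp
  | succ m ih =>
    rw [sum_range_succ, ih (by omega)]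
    have h1 : ovU q m n = (1 - q ^ (m + 1)) * ovU q (m + 1) n := by
      simp only [ovU]; rw [prod_eq_prod_Ico_succ_bot (by omega)]
    have h2 : ovU q m (n + 1) = ovU q m n * (1 - q ^ (n + 1)) := by
      simp only [ovU]; rw [prod_Ico_succ_top (by omega)]
    simp only [ovT, h2, h1, ovC_succ]
    ring

lemma ov_gauss (q : R) (n : ℕ) :
    (∏ k ∈ range n, (1 + q ^ (k + 1))) * (1 + 2 * ovS q n) = ∑ s ∈ range (n + 1), ovT q n s := by
  induction n with
  | zero => simp [ovS, ovT, ovC, ovU]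
  | succ n ih =>
    have h := ov_tel q n n le_rfl
    rw [sum_sub_distrib, ← mul_sum] at h
    rw [sum_range_succ] at ih
    rw [sum_range_succ, sum_range_succ]
    have h2 := ovC_two q (n + 1)
    rw [prod_range_succ] at h2 ⊢
    have e1 : ovU q n n = 1 := by simp [ovU]
    have e2 : ovU q n (n + 1) = 1 - q ^ (n + 1) := by simp [ovU]
    have e3 : ovU q (n + 1) (n + 1) = 1 := by simp [ovU]
    have e4 : ovS q (n + 1) = ovS q n + (-1) ^ (n + 1) * q ^ ((n + 1) ^ 2) := by
      simp [ovS, sum_range_succ]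
    have h3 := ovC_succ q n
    simp only [ovT, e1, e2, e3, e4] at *
    linear_combination (1 + q ^ (n + 1)) * ih - h - q ^ ((n + 1) ^ 2) * h2 + q ^ ((n + 1) ^ 2) * h3

lemma ov_gauss_dvd (q : R) (n : ℕ) :
    q ^ (n + 1) ∣ (∏ k ∈ range n, (1 + q ^ (k + 1))) * (1 + 2 * ovS q n)
      - ∏ k ∈ range n, (1 - q ^ (k + 1)) := by
  rw [ov_gauss, sum_range_succ']
  have : ovT q n 0 = ∏ k ∈ range n, (1 - q ^ (k + 1)) := by
    simp [ovT, ovC, ovU]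
  rw [this, add_sub_cancel_right]
  refine dvd_sum fun s _ => Dvd.dvd.mul_left (pow_dvd_pow _ ?_) _
  nlinarith
end gauss
section count
open PowerSeries

/-- allowed parts -/
def ovA (a b N : ℕ) : Finset ℕ := (Icc 1 N).filter fun k => ¬ a ∣ k ∧ ¬ b ∣ k

/-- generating function of restricted partitions -/
noncomputable def ovF (a b N : ℕ) : PowerSeries ℤ :=
  PowerSeries.mk fun n => ((Nat.Partition.restricted n (fun k => k ∈ ovA a b N)).card : ℤ)

open PowerSeries.WithPiTopology in
lemma ovF_mul (a b N : ℕ) : ovF a b N * ∏ k ∈ ovA a b N, (1 - X ^ k) = 1 := by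
  let : TopologicalSpace ℤ := ⊥
  have : DiscreteTopology ℤ := ⟨rfl⟩
  rw [ovF, Nat.Partition.powerSeriesMk_card_restricted_eq_tprod, tprod_eq_prod (s := range N)]
  · have h : ∏ k ∈ ovA a b N, (1 - (X : PowerSeries ℤ) ^ k)
        = ∏ i ∈ range N, if i + 1 ∈ ovA a b N then (1 - X ^ (i + 1)) else 1 := by
      have h1 : ∏ k ∈ ovA a b N, (1 - (X : PowerSeries ℤ) ^ k)
        = ∏ k ∈ Ico (0 + 1) (N + 1), if k ∈ ovA a b N then (1 - X ^ k) else 1 := by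
        rw [← prod_filter]
        congr 1
        ext k
        simp only [ovA, mem_filter, mem_Icc, mem_Ico]
        constructor
        · rintro ⟨h1, h2⟩; exact ⟨by omega, h1, h2⟩
        · rintro ⟨h1, h2⟩; exact h2
      rw [h1, ← prod_Ico_add', range_eq_Ico]
    rw [h, ← prod_mul_distrib]
    refine prod_eq_one fun i _ => ?_
    split_ifs
    · simp_rw [pow_mul]
      exact tsum_pow_mul_one_sub_of_constantCoeff_eq_zero (by simp)
    · simp
  · intro i hi
    rw [if_neg]
    simp only [ovA, mem_filter, mem_Icc, mem_range] at *
    omega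

lemma ov_coeff (a b N : ℕ) :
    coeff N (ovF a b N * ∏ k ∈ ovA a b N, (1 + X ^ k)) = (biregularOverpartitions a b N : ℤ) := by
  rw [prod_one_add, mul_sum, map_sum]
  have hx : ∀ t : Finset ℕ, ∏ k ∈ t, (X : PowerSeries ℤ) ^ k = X ^ (∑ k ∈ t, k) := fun t => prod_pow_eq_pow_sum t (fun k => k) X
  simp only [hx, coeff_mul_X_pow']
  rw [← sum_filter]
  simp only [ovF, coeff_mk]
  rw [← Nat.cast_sum, ← card_sigma, Nat.cast_inj, biregularOverpartitions,
    ← Set.ncard_coe_finset]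
  refine Set.ncard_congr (fun x _ => (x.2.parts, x.1.val)) ?_ ?_ ?_
  · rintro ⟨t, π⟩ h
    simp only [coe_sigma, Set.mem_sigma_iff, mem_coe, mem_filter, mem_powerset,
      Nat.Partition.restricted, mem_univ, true_and] at h
    obtain ⟨⟨h1, h2⟩, h3⟩ := h
    refine ⟨fun x hx => ?_, fun x hx => ?_, t.nodup, ?_⟩
    · have := h3 x hx
      simp only [ovA, mem_filter, mem_Icc] at this
      exact ⟨this.1.1, this.2⟩
    · have := h1 hx
      simp only [ovA, mem_filter, mem_Icc] at this
      exact ⟨this.1.1, this.2⟩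
    · have : t.val.sum = ∑ x ∈ t, x := by rw [Finset.sum, Multiset.map_id']
      simp only [π.parts_sum, this]
      omega
  · rintro ⟨t, π⟩ ⟨t', π'⟩ _ _ h
    simp only [Prod.mk.injEq] at h
    obtain ⟨h1, h2⟩ := h
    obtain rfl := Finset.val_injective h2
    obtain rfl := Nat.Partition.ext h1
    rfl
  · rintro ⟨u, v⟩ ⟨h1, h2, h3, h4⟩
    simp only at h1 h2 h3 h4
    have hs : ∑ x ∈ (⟨v, h3⟩ : Finset ℕ), x = v.sum := by simp [Finset.sum]
    refine ⟨⟨⟨v, h3⟩, ⟨u, fun {i} hi => (h1 i hi).1, by omega⟩⟩, ?_, rfl⟩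
    simp only [coe_sigma, Set.mem_sigma_iff, mem_coe, mem_filter, mem_powerset,
      Nat.Partition.restricted, mem_univ, true_and]
    refine ⟨⟨fun x hx => ?_, by omega⟩, fun x hx => ?_⟩
    · have := h2 x hx
      have := Multiset.le_sum_of_mem (show x ∈ v from hx)
      simp only [ovA, mem_filter, mem_Icc]
      exact ⟨by omega, by tauto⟩
    · have := h1 x hx
      have := Multiset.le_sum_of_mem hx
      simp only [ovA, mem_filter, mem_Icc]
      exact ⟨by omega, by tauto⟩

lemma ov_mult {R : Type*} [CommMonoid R] (f : ℕ → R) (a N : ℕ) (ha : 0 < a) :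
    ∏ k ∈ (Icc 1 N).filter (a ∣ ·), f k = ∏ k ∈ range (N / a), f (a * (k + 1)) := by
  symm
  refine prod_bij (fun k _ => a * (k + 1)) ?_ ?_ ?_ ?_
  · intro k hk
    rw [mem_range, Nat.lt_iff_add_one_le, Nat.le_div_iff_mul_le ha] at hk
    simp only [mem_filter, mem_Icc]
    exact ⟨⟨by nlinarith, by nlinarith⟩, dvd_mul_right _ _⟩
  · intro x _ y _ h
    have := Nat.eq_of_mul_eq_mul_left ha h
    omega
  · intro k hk
    simp only [mem_filter, mem_Icc] at hk
    obtain ⟨⟨h1, h2⟩, c, rfl⟩ := hk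
    have hc : 0 < c := Nat.pos_of_mul_pos_left h1 |> fun _ => by
      rcases Nat.eq_zero_or_pos c with rfl | h
      · simp at h1
      · exact h
    refine ⟨c - 1, ?_, by rw [Nat.sub_add_cancel hc]⟩
    rw [mem_range, Nat.lt_iff_add_one_le, Nat.le_div_iff_mul_le ha, Nat.sub_add_cancel hc]
    linarith
  · intros; rfl

lemma ov_split {R : Type*} [CommMonoid R] (f : ℕ → R) (a b N : ℕ) (h : a.Coprime b) :
    (∏ k ∈ (Icc 1 N).filter (1 ∣ ·), f k) * ∏ k ∈ (Icc 1 N).filter (a * b ∣ ·), f k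
     = (∏ k ∈ ovA a b N, f k) * (∏ k ∈ (Icc 1 N).filter (a ∣ ·), f k)
       * ∏ k ∈ (Icc 1 N).filter (b ∣ ·), f k := by
  simp only [ovA, prod_filter, ← prod_mul_distrib]
  refine prod_congr rfl fun k _ => ?_
  have : a * b ∣ k ↔ a ∣ k ∧ b ∣ k :=
    ⟨fun h => ⟨dvd_of_mul_right_dvd h, dvd_of_mul_left_dvd h⟩, fun ⟨h1, h2⟩ => h.mul_dvd_of_dvd_of_dvd h1 h2⟩
  by_cases h1 : a ∣ k <;> by_cases h2 : b ∣ k <;> simp [this, h1, h2]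

/-- support condition -/
def ovSupp (f : PowerSeries ℤ) : Prop :=
  ∀ e, coeff e f ≠ 0 → e % 9 = 0 ∨ e % 9 = 1 ∨ e % 9 = 4 ∨ e % 9 = 7

lemma ovSupp_coeff {f : PowerSeries ℤ} (hf : ovSupp f) {N : ℕ} (hN : N % 9 = 3 ∨ N % 9 = 6) :
    coeff N f = 0 := by
  by_contra h
  have := hf N h
  omega

lemma ovSupp_mul {f g : PowerSeries ℤ} (hf : ovSupp f) (hg : ovSupp g) {N : ℕ}
    (hN : N % 9 = 3 ∨ N % 9 = 6) : coeff N (f * g) = 0 := by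
  rw [coeff_mul]
  refine sum_eq_zero fun x hx => ?_
  rw [HasAntidiagonal.mem_antidiagonal] at hx
  by_contra h
  have h1 := hf x.1 (left_ne_zero_of_mul h)
  have h2 := hg x.2 (right_ne_zero_of_mul h)
  omega
end count

section final
open PowerSeries

/-- truncated product with plus signs -/
noncomputable def ovP (m N : ℕ) : PowerSeries ℤ := ∏ k ∈ (Icc 1 N).filter (m ∣ ·), (1 + X ^ k)
/-- truncated product with minus signs -/
noncomputable def ovM (m N : ℕ) : PowerSeries ℤ := ∏ k ∈ (Icc 1 N).filter (m ∣ ·), (1 - X ^ k)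

lemma ov_theta (m N : ℕ) (hm : 0 < m) :
    (X : PowerSeries ℤ) ^ (N + 1) ∣ ovP m N * (1 + 2 * ovS (X ^ m) (N / m)) - ovM m N := by
  have h := ov_gauss_dvd ((X : PowerSeries ℤ) ^ m) (N / m)
  rw [ovP, ovM, ov_mult _ _ _ hm, ov_mult _ _ _ hm]
  simp_rw [← pow_mul] at h ⊢
  refine (pow_dvd_pow _ ?_).trans h
  have := Nat.lt_mul_div_succ N hm
  omega

lemma ovP_unit (m N : ℕ) : IsUnit (ovP m N) := by
  rw [PowerSeries.isUnit_iff_constantCoeff, ovP, map_prod, prod_eq_one]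
  · exact isUnit_one
  · intro k hk
    simp only [mem_filter, mem_Icc] at hk
    have : k ≠ 0 := by omega
    simp [this]

lemma ovSupp_S (m n : ℕ) (hm : (∃ c, m = c ^ 2) ∨ 9 ∣ m) : ovSupp (ovS (X ^ m) n) := by
  intro e he
  rw [ovS, map_sum] at he
  obtain ⟨j, -, hj⟩ := exists_ne_zero_of_sum_ne_zero he
  have h1 : ((-1 : PowerSeries ℤ)) ^ (j + 1) = C ((-1) ^ (j + 1)) := by simp
  rw [h1, coeff_C_mul, ← pow_mul, coeff_X_pow] at hj
  have h2 : e = m * (j + 1) ^ 2 := by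
    by_contra h
    simp [h] at hj
  subst h2
  rcases hm with ⟨c, rfl⟩ | ⟨c, rfl⟩
  · rw [← mul_pow, Nat.pow_mod]
    have : c * (j + 1) % 9 < 9 := Nat.mod_lt _ (by norm_num)
    generalize c * (j + 1) % 9 = x at this
    interval_cases x <;> simp
  · left
    rw [mul_assoc, Nat.mul_mod_right]

lemma ov_main (a b N : ℕ) (ha : 0 < a) (hb : 0 < b) (hab : a.Coprime b) :
    (X : PowerSeries ℤ) ^ (N + 1) ∣
      (ovF a b N * ∏ k ∈ ovA a b N, (1 + X ^ k)) * (1 + 2 * ovS (X ^ 1) (N / 1))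
        * (1 + 2 * ovS (X ^ (a * b)) (N / (a * b)))
      - (1 + 2 * ovS (X ^ a) (N / a)) * (1 + 2 * ovS (X ^ b) (N / b)) := by
  have hP : ovP 1 N * ovP (a * b) N = _ := ov_split (fun k => 1 + (X : PowerSeries ℤ) ^ k) a b N hab
  have hM : ovM 1 N * ovM (a * b) N = _ := ov_split (fun k => 1 - (X : PowerSeries ℤ) ^ k) a b N hab
  rw [← ovP, ← ovP] at hP
  rw [← ovM, ← ovM] at hM
  obtain ⟨r1, h1⟩ := ov_theta 1 N one_pos
  obtain ⟨ra, h2⟩ := ov_theta a N ha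
  obtain ⟨rb, h3⟩ := ov_theta b N hb
  obtain ⟨rab, h4⟩ := ov_theta (a * b) N (Nat.mul_pos ha hb)
  have hF := ovF_mul a b N
  have hu := (ovP_unit 1 N).mul (ovP_unit (a * b) N)
  rw [← hu.dvd_mul_left]
  generalize ovS (X ^ 1 : PowerSeries ℤ) (N / 1) = S1 at *
  generalize ovS (X ^ a : PowerSeries ℤ) (N / a) = Sa at *
  generalize ovS (X ^ b : PowerSeries ℤ) (N / b) = Sb at *
  generalize ovS (X ^ (a * b) : PowerSeries ℤ) (N / (a * b)) = Sab at *
  generalize ovP 1 N = P1 at *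
  generalize ovP a N = Pa at *
  generalize ovP b N = Pb at *
  generalize ovP (a * b) N = Pab at *
  generalize ovM 1 N = M1 at *
  generalize ovM a N = Ma at *
  generalize ovM b N = Mb at *
  generalize ovM (a * b) N = Mab at *
  generalize ovF a b N = F at *
  generalize (∏ k ∈ ovA a b N, (1 + (X : PowerSeries ℤ) ^ k)) = Ps at *
  generalize (∏ k ∈ ovA a b N, (1 - (X : PowerSeries ℤ) ^ k)) = Ms at *
  generalize (X : PowerSeries ℤ) ^ (N + 1) = Z at *
  refine ⟨F * Ps * (r1 * (Pab * (1 + 2 * Sab)) + M1 * rab)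
    - Ps * (ra * (Pb * (1 + 2 * Sb)) + Ma * rb), ?_⟩
  linear_combination (F * Ps * (Pab * (1 + 2 * Sab))) * h1 + F * Ps * M1 * h4
    - Ps * (Pb * (1 + 2 * Sb)) * h2 - Ps * Ma * h3 + F * Ps * hM + Ps * Ma * Mb * hF
    - (1 + 2 * Sa) * (1 + 2 * Sb) * hP

lemma ov_final (a b N : ℕ) (ha : 0 < a) (hb : 0 < b) (hab : a.Coprime b)
    (ha2 : ∃ c, a = c ^ 2) (hb9 : 9 ∣ b) (hN : N % 9 = 3 ∨ N % 9 = 6) :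
    8 ∣ biregularOverpartitions a b N := by
  rw [← Int.natCast_dvd_natCast, ← ov_coeff]
  obtain ⟨r, h⟩ := ov_main a b N ha hb hab
  have s1 : ovSupp (ovS (X ^ 1) (N / 1)) := ovSupp_S _ _ (Or.inl ⟨1, rfl⟩)
  have sa : ovSupp (ovS (X ^ a) (N / a)) := ovSupp_S _ _ (Or.inl ha2)
  have sb : ovSupp (ovS (X ^ b) (N / b)) := ovSupp_S _ _ (Or.inr hb9)
  have sab : ovSupp (ovS (X ^ (a * b)) (N / (a * b))) :=
    ovSupp_S _ _ (Or.inr (hb9.mul_left a))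
  generalize ovS (X ^ 1 : PowerSeries ℤ) (N / 1) = S1 at *
  generalize ovS (X ^ a : PowerSeries ℤ) (N / a) = Sa at *
  generalize ovS (X ^ b : PowerSeries ℤ) (N / b) = Sb at *
  generalize ovS (X ^ (a * b) : PowerSeries ℤ) (N / (a * b)) = Sab at *
  generalize (ovF a b N * ∏ k ∈ ovA a b N, (1 + (X : PowerSeries ℤ) ^ k)) = G at *
  have key : ∃ E E' : PowerSeries ℤ, G = 1 + C 2 * (Sa + Sb - S1 - Sab)
      + C 4 * (Sa * Sb + S1 * S1 + Sab * Sab - Sa * S1 - Sa * Sab - Sb * S1 - Sb * Sab + S1 * Sab)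
      + C 8 * E + X ^ (N + 1) * E' := by
    have c2 : (C 2 : PowerSeries ℤ) = 2 := by simp
    have c4 : (C 4 : PowerSeries ℤ) = 4 := by simp
    have c8 : (C 8 : PowerSeries ℤ) = 8 := by simp
    let L := Sa + Sb
    let K := Sa * Sb
    let L' := - S1 - Sab
    let K' := S1 * S1 + Sab * Sab + S1 * Sab
    let H := - S1 * Sab * Sab - S1 * S1 * Sab + 2 * S1 * S1 * Sab * Sab
    refine ⟨L * K' + K * L' + 2 * K * K' + (1 + 2 * L + 4 * K) * H
        - G * (S1 ^ 3 + Sab ^ 3 + 8 * S1 ^ 3 * Sab ^ 3),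
      r * ((1 - 2 * S1 + 4 * S1 ^ 2) * (1 - 2 * Sab + 4 * Sab ^ 2)), ?_⟩
    rw [c2, c4, c8]
    simp only [L, K, L', K', H]
    linear_combination ((1 - 2 * S1 + 4 * S1 ^ 2) * (1 - 2 * Sab + 4 * Sab ^ 2)) * h
  obtain ⟨E, E', hG⟩ := key
  have hN0 : N ≠ 0 := by omega
  have hz : coeff N (X ^ (N + 1) * E') = 0 := by
    rw [coeff_X_pow_mul']; simp
  rw [hG]
  simp only [map_add, map_sub, coeff_C_mul, hz, ovSupp_coeff s1 hN, ovSupp_coeff sa hN,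
    ovSupp_coeff sb hN, ovSupp_coeff sab hN, ovSupp_mul sa sb hN, ovSupp_mul s1 s1 hN,
    ovSupp_mul sab sab hN, ovSupp_mul sa s1 hN, ovSupp_mul sa sab hN, ovSupp_mul sb s1 hN,
    ovSupp_mul sb sab hN, ovSupp_mul s1 sab hN, coeff_one, hN0]
  simp
end final
end helpers

theorem biregular_overpartition_pow2even_pow3_9n3i_mod8 (n α β i : ℕ) (hα : 1 ≤ α)
    (hβ : 2 ≤ β) (hi : i = 1 ∨ i = 2) :
    8 ∣ biregularOverpartitions (2 ^ (2 * α)) (3 ^ β) (9 * n + 3 * i) := by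
  refine ov_final _ _ _ (by positivity) (by positivity) ?_ ⟨2 ^ α, by rw [← pow_mul, mul_comm]⟩ ?_ ?_
  · exact Nat.Coprime.pow _ _ (by norm_num)
  · exact (show (9 : ℕ) = 3 ^ 2 by norm_num) ▸ pow_dvd_pow 3 hβ
  · omega
end

section
/- Let α ≥ 2, β ≥ 1 and n ≥ 0 be integers. If either (α is odd and β is even) or (α and β are both even), then the number of (2^α, 3^β)-biregular overpartitions of 12n+7 is divisible by 8, i.e. B̄_{2^α,3^β}(12n+7) ≡ 0 (mod 8). -/
/-- Multisets of admissible positive parts with sum `N`. -/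
noncomputable def bopLam (A : ℕ → Prop) (N : ℕ) : Finset (Multiset ℕ) :=
  open Classical in
  ((Finset.univ : Finset (Nat.Partition N)).image Nat.Partition.parts).filter
    (fun s => ∀ x ∈ s, A x)

/-- Pairs `(k, m)` with `k * m = N`, `k` admissible. -/
noncomputable def bopP (A : ℕ → Prop) (N : ℕ) : Finset (ℕ × ℕ) :=
  open Classical in
  (Nat.divisorsAntidiagonal N).filter (fun p => A p.1)

/-- Quadruples `k₁ m₁ + k₂ m₂ = N`. -/
noncomputable def bopS (A : ℕ → Prop) (N : ℕ) : Finset ((ℕ × ℕ) × (ℕ × ℕ)) :=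
  open Classical in
  ((Finset.Icc 1 N ×ˢ Finset.Icc 1 N) ×ˢ (Finset.Icc 1 N ×ˢ Finset.Icc 1 N)).filter
    (fun p => A p.1.1 ∧ A p.2.1 ∧ p.1.1 * p.1.2 + p.2.1 * p.2.2 = N)

lemma mem_bopLam (A : ℕ → Prop) (N : ℕ) (s : Multiset ℕ) :
    s ∈ bopLam A N ↔ (∀ x ∈ s, 0 < x ∧ A x) ∧ s.sum = N := by
  classical
  simp only [bopLam, Finset.mem_filter, Finset.mem_image, Finset.mem_univ, true_and]
  constructor
  · rintro ⟨⟨p, rfl⟩, h⟩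
    exact ⟨fun x hx => ⟨p.parts_pos hx, h x hx⟩, p.parts_sum⟩
  · rintro ⟨h, hs⟩
    exact ⟨⟨⟨s, fun hx => (h _ hx).1, hs⟩, rfl⟩, fun x hx => (h x hx).2⟩

lemma mem_bopP (A : ℕ → Prop) (N : ℕ) (p : ℕ × ℕ) :
    p ∈ bopP A N ↔ (p.1 * p.2 = N ∧ N ≠ 0) ∧ A p.1 := by
  classical
  simp [bopP]

lemma mem_bopS (A : ℕ → Prop) (N : ℕ) (p : (ℕ × ℕ) × (ℕ × ℕ)) :
    p ∈ bopS A N ↔ (0 < p.1.1 ∧ 0 < p.1.2 ∧ 0 < p.2.1 ∧ 0 < p.2.2) ∧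
      A p.1.1 ∧ A p.2.1 ∧ p.1.1 * p.1.2 + p.2.1 * p.2.2 = N := by
  classical
  obtain ⟨⟨a, b⟩, ⟨c, d⟩⟩ := p
  simp only [bopS, Finset.mem_filter, Finset.mem_product, Finset.mem_Icc]
  constructor
  · rintro ⟨h, h'⟩
    exact ⟨by omega, h'⟩
  · rintro ⟨⟨h1, h2, h3, h4⟩, h5, h6, h7⟩
    refine ⟨?_, h5, h6, h7⟩
    have := Nat.le_mul_of_pos_right a h2
    have := Nat.le_mul_of_pos_left b h1
    have := Nat.le_mul_of_pos_right c h4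
    have := Nat.le_mul_of_pos_left d h3
    omega

lemma bop_ncard (A : ℕ → Prop) (N : ℕ) :
    Set.ncard {p : Multiset ℕ × Multiset ℕ |
      (∀ x ∈ p.1, 0 < x ∧ A x) ∧ (∀ x ∈ p.2, 0 < x ∧ A x) ∧
      p.2.Nodup ∧ p.1.sum + p.2.sum = N} = ∑ s ∈ bopLam A N, 2 ^ s.toFinset.card := by
  classical
  have key : {p : Multiset ℕ × Multiset ℕ |
      (∀ x ∈ p.1, 0 < x ∧ A x) ∧ (∀ x ∈ p.2, 0 < x ∧ A x) ∧
      p.2.Nodup ∧ p.1.sum + p.2.sum = N} =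
      (((bopLam A N).sigma (fun s => s.toFinset.powerset)).image
        (fun x : (_ : Multiset ℕ) × Finset ℕ => (x.1 - x.2.val, x.2.val)) :
        Finset (Multiset ℕ × Multiset ℕ)) := by
    ext ⟨s, t⟩
    simp only [Set.mem_ofPred_eq, Finset.coe_image, Set.mem_image, Finset.mem_coe,
      Finset.mem_sigma, Finset.mem_powerset, mem_bopLam, Prod.mk.injEq, Sigma.exists]
    constructor
    · rintro ⟨h1, h2, h3, h4⟩
      refine ⟨s + t, ⟨t, h3⟩, ⟨⟨?_, by simpa using h4⟩, ?_⟩, by simp, rfl⟩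
      · intro x hx
        rcases Multiset.mem_add.1 hx with h | h
        exacts [h1 x h, h2 x h]
      · intro x hx
        simp only [Multiset.mem_toFinset, Multiset.mem_add]
        exact Or.inr hx
    · rintro ⟨l, u, ⟨⟨h1, h2⟩, h3⟩, rfl, rfl⟩
      have hle : u.val ≤ l := (Multiset.le_iff_subset u.nodup).2
        (fun x hx => Multiset.mem_toFinset.1 (h3 hx))
      refine ⟨fun x hx => h1 x (Multiset.mem_of_le (Multiset.sub_le_self _ _) hx),
        fun x hx => h1 x (Multiset.mem_of_le hle hx), u.nodup, ?_⟩
      rw [← Multiset.sum_add, Multiset.sub_add_cancel hle, h2]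
  rw [key, Set.ncard_coe_finset, Finset.card_image_of_injOn, Finset.card_sigma]
  · simp
  · rintro ⟨l, u⟩ h ⟨l', u'⟩ h' he
    simp only [Finset.coe_sigma, Set.mem_sigma_iff, Finset.mem_coe, Finset.mem_powerset] at h h'
    simp only [Prod.mk.injEq] at he
    obtain ⟨h1, h2⟩ := he
    have hu : u = u' := Finset.val_injective h2
    subst hu
    have hle : u.val ≤ l := (Multiset.le_iff_subset u.nodup).2
        (fun x hx => Multiset.mem_toFinset.1 (h.2 hx))
    have hle' : u.val ≤ l' := (Multiset.le_iff_subset u.nodup).2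
        (fun x hx => Multiset.mem_toFinset.1 (h'.2 hx))
    have : l = l' := by
      rw [← Multiset.sub_add_cancel hle, h1, Multiset.sub_add_cancel hle']
    rw [this]

lemma bop_toFinset_replicate (m k : ℕ) (hm : 0 < m) :
    (Multiset.replicate m k).toFinset = {k} := by
  rw [Multiset.toFinset_replicate, if_neg hm.ne']

lemma bop_fiberP (A : ℕ → Prop) (N : ℕ) (hN : 0 < N) (s : Multiset ℕ) (hs : s ∈ bopLam A N) :
    ((bopP A N).filter (fun p => Multiset.replicate p.2 p.1 = s)).card =
      if s.toFinset.card = 1 then 1 else 0 := by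
  classical
  rw [mem_bopLam] at hs
  split_ifs with h
  · obtain ⟨a, ha⟩ := Finset.card_eq_one.1 h
    have has : a ∈ s := Multiset.mem_toFinset.1 (by simp [ha])
    have hrep : s = Multiset.replicate (s.count a) a := by
      rw [← Multiset.card_replicate (s.count a) a]
      have : s = Multiset.replicate s.card a := Multiset.eq_replicate_card.2 (fun b hb => by
        have : b ∈ s.toFinset := Multiset.mem_toFinset.2 hb
        simpa [ha] using this)
      conv_lhs => rw [this]
      rw [this]; simp
    rw [Finset.card_eq_one]
    refine ⟨(a, s.count a), ?_⟩
    ext ⟨k, m⟩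
    simp only [Finset.mem_filter, mem_bopP, Finset.mem_singleton, Prod.mk.injEq]
    constructor
    · rintro ⟨⟨⟨h1, h2⟩, h3⟩, rfl⟩
      have hm : 0 < m := Nat.pos_of_ne_zero (by rintro rfl; simp at h1; omega)
      rw [bop_toFinset_replicate m k hm] at ha
      have : k = a := by simpa using ha
      subst this
      simp
    · rintro ⟨rfl, rfl⟩
      refine ⟨⟨⟨?_, hN.ne'⟩, (hs.1 _ has).2⟩, hrep.symm⟩
      have := hs.2
      rw [hrep] at this
      simpa [mul_comm] using this
  · rw [Finset.card_eq_zero, Finset.filter_eq_empty_iff]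
    rintro ⟨k, m⟩ hp rfl
    rw [mem_bopP] at hp
    have hm : 0 < m := Nat.pos_of_ne_zero (by rintro rfl; simp at hp; omega)
    apply h
    rw [bop_toFinset_replicate m k hm]; simp

lemma bop_fiberQ (A : ℕ → Prop) (N : ℕ) (s : Multiset ℕ) (hs : s ∈ bopLam A N) :
    (((bopS A N).filter (fun p => p.1.1 ≠ p.2.1)).filter
      (fun p => Multiset.replicate p.1.2 p.1.1 + Multiset.replicate p.2.2 p.2.1 = s)).card =
      if s.toFinset.card = 2 then 2 else 0 := by
  classical
  rw [mem_bopLam] at hs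
  split_ifs with h
  · obtain ⟨a, b, hab, hs2⟩ := Finset.card_eq_two.1 h
    have has : a ∈ s := Multiset.mem_toFinset.1 (by simp [hs2])
    have hbs : b ∈ s := Multiset.mem_toFinset.1 (by simp [hs2])
    have hrep : s = Multiset.replicate (s.count a) a + Multiset.replicate (s.count b) b := by
      ext x
      simp only [Multiset.count_add, Multiset.count_replicate]
      by_cases hxa : a = x
      · subst hxa; simp [hab.symm]
      · by_cases hxb : b = x
        · subst hxb; simp [hxa]
        · simp only [hxa, hxb, if_false]
          rw [Multiset.count_eq_zero, ← Multiset.mem_toFinset, hs2]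
          simp [Ne.symm hxa, Ne.symm hxb]
    have hsum : a * s.count a + b * s.count b = N := by
      have := hs.2
      rw [hrep] at this
      simpa [mul_comm] using this
    have hca := Multiset.count_pos.2 has
    have hcb := Multiset.count_pos.2 hbs
    have hA := hs.1 _ has
    have hB := hs.1 _ hbs
    rw [Finset.card_eq_two]
    refine ⟨((a, s.count a), (b, s.count b)), ((b, s.count b), (a, s.count a)),
      by simp [hab], ?_⟩
    ext ⟨⟨k, m⟩, ⟨k', m'⟩⟩
    simp only [Finset.mem_filter, mem_bopS, Finset.mem_insert, Finset.mem_singleton,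
      Prod.mk.injEq]
    constructor
    · rintro ⟨⟨⟨⟨h1, h2, h3, h4⟩, h5, h6, h7⟩, h8⟩, rfl⟩
      have e : ({k, k'} : Finset ℕ) = {a, b} := by
        rw [← hs2, Multiset.toFinset_add, bop_toFinset_replicate m k h2,
          bop_toFinset_replicate m' k' h4]; rfl
      have hk : k = a ∨ k = b := by
        have : k ∈ ({a, b} : Finset ℕ) := by rw [← e]; simp
        simpa using this
      have hk' : k' = a ∨ k' = b := by
        have : k' ∈ ({a, b} : Finset ℕ) := by rw [← e]; simp
        simpa using this
      rcases hk with rfl | rfl <;> rcases hk' with rfl | rfl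
      · exact absurd rfl h8
      · left; simp [Multiset.count_replicate, h8, Ne.symm h8]
      · right; simp [Multiset.count_replicate, h8, Ne.symm h8]
      · exact absurd rfl h8
    · rintro (⟨⟨rfl, rfl⟩, rfl, rfl⟩ | ⟨⟨rfl, rfl⟩, rfl, rfl⟩)
      · exact ⟨⟨⟨⟨hA.1, hca, hB.1, hcb⟩, hA.2, hB.2, hsum⟩, hab⟩, hrep.symm⟩
      · exact ⟨⟨⟨⟨hB.1, hcb, hA.1, hca⟩, hB.2, hA.2, by rw [add_comm]; exact hsum⟩, hab.symm⟩,
          by rw [add_comm]; exact hrep.symm⟩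
  · rw [Finset.card_eq_zero, Finset.filter_eq_empty_iff]
    rintro ⟨⟨k, m⟩, ⟨k', m'⟩⟩ hp rfl
    simp only [Finset.mem_filter, mem_bopS] at hp
    obtain ⟨⟨⟨h1, h2, h3, h4⟩, h5, h6, h7⟩, h8⟩ := hp
    apply h
    simp only
    rw [Multiset.toFinset_add, bop_toFinset_replicate m k h2,
          bop_toFinset_replicate m' k' h4]
    exact Finset.card_pair h8

lemma bop_mod8 (A : ℕ → Prop) (N : ℕ) (hN : 0 < N) :
    (∑ s ∈ bopLam A N, 2 ^ s.toFinset.card) ≡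
      2 * (bopP A N).card + 2 * ((bopS A N).filter (fun p => p.1.1 ≠ p.2.1)).card [MOD 8] := by
  classical
  rw [Finset.card_eq_sum_card_fiberwise (s := bopP A N) (t := bopLam A N)
      (f := fun p => Multiset.replicate p.2 p.1),
    Finset.card_eq_sum_card_fiberwise (s := (bopS A N).filter (fun p => p.1.1 ≠ p.2.1))
      (t := bopLam A N)
      (f := fun p => Multiset.replicate p.1.2 p.1.1 + Multiset.replicate p.2.2 p.2.1),
    Finset.mul_sum, Finset.mul_sum, ← Finset.sum_add_distrib]
  · rw [← ZMod.natCast_eq_natCast_iff]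
    push_cast
    refine Finset.sum_congr rfl fun s hs => ?_
    rw [bop_fiberP A N hN s hs, bop_fiberQ A N s hs]
    have hd : s.toFinset.card ≠ 0 := by
      intro h0
      rw [Finset.card_eq_zero, Multiset.toFinset_eq_empty] at h0
      subst h0
      have := ((mem_bopLam A N 0).1 hs).2
      simp at this; omega
    generalize s.toFinset.card = d at hd
    match d, hd with
    | 1, _ => simp
    | 2, _ => norm_num
    | d + 3, _ =>
      have : (2 : ZMod 8) ^ (d + 3) = 0 := by
        rw [pow_add, show (2 : ZMod 8) ^ 3 = 0 from by decide, mul_zero]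
      simp [this]
  · rintro ⟨⟨k, m⟩, ⟨k', m'⟩⟩ hp
    simp only [Finset.coe_filter, Set.mem_ofPred_eq, mem_bopS] at hp
    obtain ⟨⟨⟨h1, h2, h3, h4⟩, h5, h6, h7⟩, h8⟩ := hp
    simp only [Finset.mem_coe, mem_bopLam]
    refine ⟨?_, by simpa [mul_comm] using h7⟩
    intro x hx
    rcases Multiset.mem_add.1 hx with h | h <;> rw [Multiset.eq_of_mem_replicate h]
    exacts [⟨h1, h5⟩, ⟨h3, h6⟩]
  · rintro ⟨k, m⟩ hp
    simp only [Finset.mem_coe, mem_bopP] at hp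
    obtain ⟨⟨h1, h2⟩, h3⟩ := hp
    simp only [Finset.mem_coe, mem_bopLam]
    refine ⟨?_, by simpa [mul_comm] using h1⟩
    intro x hx
    rw [Multiset.eq_of_mem_replicate hx]
    exact ⟨Nat.pos_of_ne_zero (by rintro rfl; simp at h1; omega), h3⟩

lemma bop_diag (A : ℕ → Prop) (N : ℕ) (hN : 0 < N) :
    ((bopS A N).filter (fun p => p.1.1 = p.2.1)).card = ∑ p ∈ bopP A N, (p.2 - 1) := by
  classical
  rw [Finset.card_eq_sum_card_fiberwise (t := bopP A N) (f := fun p => (p.1.1, p.1.2 + p.2.2))]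
  · refine Finset.sum_congr rfl ?_
    rintro ⟨k, m⟩ hp
    rw [mem_bopP] at hp
    obtain ⟨⟨h1, h2⟩, h3⟩ := hp
    simp only at h1 h3 ⊢
    have hk : 0 < k := Nat.pos_of_ne_zero (by rintro rfl; simp at h1; omega)
    have : (m - 1) = (Finset.Ioo 0 m).card := by simp
    rw [this]
    symm
    refine Finset.card_bij (fun i _ => ((k, i), (k, m - i))) ?_ ?_ ?_
    · intro i hi
      rw [Finset.mem_Ioo] at hi
      simp only [Finset.mem_filter, mem_bopS, Prod.mk.injEq, true_and, and_true]
      refine ⟨⟨⟨hk, hi.1, hk, by omega⟩, h3, h3, ?_⟩, by omega⟩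
      rw [← mul_add, Nat.add_sub_cancel' hi.2.le, h1]
    · intro i _ j _ h
      simp only [Prod.mk.injEq, true_and] at h
      exact h.1
    · rintro ⟨⟨a, b⟩, ⟨c, d⟩⟩ h
      simp only [Finset.mem_filter, mem_bopS, Prod.mk.injEq] at h
      obtain ⟨⟨⟨⟨g1, g2, g3, g4⟩, g5, g6, g7⟩, rfl⟩, rfl, rfl⟩ := h
      exact ⟨b, Finset.mem_Ioo.2 ⟨g2, by omega⟩, by simp⟩
  · rintro ⟨⟨a, b⟩, ⟨c, d⟩⟩ h
    simp only [Finset.coe_filter, Set.mem_ofPred_eq, mem_bopS] at h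
    obtain ⟨⟨⟨g1, g2, g3, g4⟩, g5, g6, g7⟩, rfl⟩ := h
    simp only [Finset.mem_coe, mem_bopP]
    exact ⟨⟨by rw [mul_add]; exact g7, hN.ne'⟩, g5⟩

lemma bop_S_card (A : ℕ → Prop) (N : ℕ) :
    (bopS A N).card = ∑ ij ∈ Finset.HasAntidiagonal.antidiagonal N, (bopP A ij.1).card * (bopP A ij.2).card := by
  classical
  rw [Finset.card_eq_sum_card_fiberwise (t := Finset.HasAntidiagonal.antidiagonal N)
    (f := fun p => (p.1.1 * p.1.2, p.2.1 * p.2.2))]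
  · refine Finset.sum_congr rfl ?_
    rintro ⟨i, j⟩ hij
    rw [Finset.HasAntidiagonal.mem_antidiagonal] at hij
    simp only at hij
    rw [← Finset.card_product]
    congr 1
    ext ⟨⟨a, b⟩, ⟨c, d⟩⟩
    simp only [Finset.mem_filter, Finset.mem_product, mem_bopS, mem_bopP, Prod.mk.injEq]
    constructor
    · rintro ⟨⟨⟨g1, g2, g3, g4⟩, g5, g6, g7⟩, rfl, rfl⟩
      exact ⟨⟨⟨rfl, (Nat.mul_pos g1 g2).ne'⟩, g5⟩, ⟨rfl, (Nat.mul_pos g3 g4).ne'⟩, g6⟩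
    · rintro ⟨⟨⟨rfl, h1⟩, g5⟩, ⟨rfl, h2⟩, g6⟩
      have := Nat.pos_of_ne_zero (left_ne_zero_of_mul h1)
      have := Nat.pos_of_ne_zero (right_ne_zero_of_mul h1)
      have := Nat.pos_of_ne_zero (left_ne_zero_of_mul h2)
      have := Nat.pos_of_ne_zero (right_ne_zero_of_mul h2)
      exact ⟨⟨⟨by assumption, by assumption, by assumption, by assumption⟩, g5, g6, hij⟩, rfl, rfl⟩
  · rintro ⟨⟨a, b⟩, ⟨c, d⟩⟩ h
    simp only [Finset.mem_coe, mem_bopS] at h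
    simp only [Finset.mem_coe, Finset.HasAntidiagonal.mem_antidiagonal]
    exact h.2.2.2

lemma bop_nonsq (k : ℕ) : k * k % 4 ≠ 2 ∧ k * k % 4 ≠ 3 := by
  have : k % 4 < 4 := Nat.mod_lt _ (by norm_num)
  rw [Nat.mul_mod]
  interval_cases k % 4 <;> simp

/-- sum over all divisor pairs -/
lemma bop_sum_all {R : Type*} [CommRing R] (f : ℕ → R) (M : ℕ) (hM : M % 4 = 2 ∨ M % 4 = 3)
    (hf : ∀ a b, a * b = M → f a + f b = 0) :
    ∑ p ∈ Nat.divisorsAntidiagonal M, f p.2 = 0 := by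
  refine Finset.sum_involution (fun p _ => p.swap) ?_ ?_ ?_ ?_
  · rintro ⟨a, b⟩ h
    rw [Nat.mem_divisorsAntidiagonal] at h
    exact hf b a (by rw [mul_comm]; exact h.1)
  · rintro ⟨a, b⟩ h _ he
    rw [Nat.mem_divisorsAntidiagonal] at h
    simp only [Prod.swap_prod_mk, Prod.mk.injEq] at he
    obtain ⟨rfl, _⟩ := he
    have := bop_nonsq b
    simp only at h
    rw [h.1] at this
    omega
  · rintro ⟨a, b⟩ h
    rw [Nat.mem_divisorsAntidiagonal] at h ⊢
    simpa [mul_comm] using h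
  · rintro ⟨a, b⟩ h
    rfl

lemma bop_b_mod (b : ℕ) (hb : b % 4 = 1) (u M : ℕ) (h : b * u = M) : u % 4 = M % 4 := by
  rw [← h, Nat.mul_mod, hb]; simp

/-- sum over pairs with first entry not divisible by `b` -/
lemma bop_sum_P {R : Type*} [CommRing R] (f : ℕ → R) (b N : ℕ) (hb : b % 4 = 1)
    (A : ℕ → Prop) (hA : ∀ k, k ∣ N → (A k ↔ ¬ b ∣ k))
    (hN : N % 4 = 2 ∨ N % 4 = 3)
    (hf : ∀ x y, (x * y) % 4 = N % 4 → f x + f y = 0) :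
    ∑ p ∈ bopP A N, f p.2 = 0 := by
  classical
  have hN0 : N ≠ 0 := by omega
  have hb0 : 0 < b := by omega
  have h1 : ∑ p ∈ bopP A N, f p.2 + ∑ p ∈ (Nat.divisorsAntidiagonal N).filter
      (fun p => b ∣ p.1), f p.2 = 0 := by
    rw [← bop_sum_all f N hN (fun x y h => hf x y (by rw [h])),
      ← Finset.sum_filter_not_add_sum_filter (Nat.divisorsAntidiagonal N) (fun p => b ∣ p.1)]
    congr 1
    refine Finset.sum_congr ?_ (fun _ _ => rfl)
    ext p
    rw [mem_bopP, Finset.mem_filter, Nat.mem_divisorsAntidiagonal]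
    refine and_congr_right fun h => hA _ ⟨_, h.1.symm⟩
  have h2 : ∑ p ∈ (Nat.divisorsAntidiagonal N).filter (fun p => b ∣ p.1), f p.2 = 0 := by
    by_cases hd : b ∣ N
    · obtain ⟨M, rfl⟩ := hd
      have hM := bop_b_mod b hb M _ rfl
      rw [← bop_sum_all f M (by omega) (fun x y h => hf x y (by rw [h, hM]))]
      symm
      refine Finset.sum_bij (fun p _ => (b * p.1, p.2)) ?_ ?_ ?_ ?_
      · rintro ⟨x, y⟩ h
        rw [Nat.mem_divisorsAntidiagonal] at h
        simp only [Finset.mem_filter, Nat.mem_divisorsAntidiagonal]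
        exact ⟨⟨by rw [mul_assoc, h.1], hN0⟩, dvd_mul_right _ _⟩
      · rintro ⟨x, y⟩ _ ⟨x', y'⟩ _ h
        simp only [Prod.mk.injEq] at h ⊢
        exact ⟨Nat.eq_of_mul_eq_mul_left hb0 h.1, h.2⟩
      · rintro ⟨x, y⟩ h
        simp only [Finset.mem_filter, Nat.mem_divisorsAntidiagonal] at h
        obtain ⟨⟨h1, h2⟩, ⟨u, rfl⟩⟩ := h
        refine ⟨(u, y), ?_, rfl⟩
        rw [Nat.mem_divisorsAntidiagonal]
        rw [mul_assoc] at h1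
        exact ⟨Nat.eq_of_mul_eq_mul_left hb0 h1, right_ne_zero_of_mul h2⟩
      · intros; rfl
    · rw [Finset.filter_eq_empty_iff.2, Finset.sum_empty]
      rintro ⟨x, y⟩ h hx
      rw [Nat.mem_divisorsAntidiagonal] at h
      exact hd (hx.trans ⟨y, h.1.symm⟩)
  rw [h2, add_zero] at h1
  exact h1

theorem biregular_overpartition_pow2_pow3_12n7_mod8 (n α β : ℕ) (hα : 2 ≤ α) (hβ : 1 ≤ β)
    (h : (Odd α ∧ Even β) ∨ (Even α ∧ Even β)) :
    8 ∣ biregularOverpartitions (2 ^ α) (3 ^ β) (12 * n + 7) := by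
  classical
  have hβe : Even β := by tauto
  have hb : 3 ^ β % 4 = 1 := by
    obtain ⟨c, rfl⟩ := hβe
    rw [← two_mul, pow_mul, Nat.pow_mod]; simp
  set A : ℕ → Prop := fun x => ¬ 2 ^ α ∣ x ∧ ¬ 3 ^ β ∣ x with hAdef
  set N := 12 * n + 7 with hNdef
  have hN : N % 4 = 3 := by omega
  have hA : ∀ j, (j % 4 = 2 ∨ j % 4 = 3) → ∀ k, k ∣ j → (A k ↔ ¬ 3 ^ β ∣ k) := by
    intro j hj k hk
    refine and_iff_right ?_
    intro h2
    have h4 : 4 ∣ j := ((pow_dvd_pow 2 hα).trans h2).trans hk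
    omega
  have heven : ∀ j, (j % 4 = 2 ∨ j % 4 = 3) → Even (bopP A j).card := by
    intro j hj
    have := bop_sum_P (R := ZMod 2) (fun _ => 1) (3 ^ β) j hb A (hA j hj) hj
      (fun _ _ _ => by decide)
    rw [← ZMod.natCast_eq_zero_iff_even]
    simpa using this
  have hσ : ((∑ p ∈ bopP A N, p.2 : ℕ) : ZMod 4) = 0 := by
    push_cast
    refine bop_sum_P (R := ZMod 4) (fun x => (x : ZMod 4)) (3 ^ β) N hb A (hA N (Or.inr hN))
      (Or.inr hN) ?_
    intro x y hxy
    rw [hN] at hxy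
    have h3 : ((x : ZMod 4)) * (y : ZMod 4) = 3 := by
      have : ((x * y : ℕ) : ZMod 4) = ((3 : ℕ) : ZMod 4) := by
        rw [ZMod.natCast_eq_natCast_iff]; exact hxy
      exact_mod_cast this
    generalize (x : ZMod 4) = u at *
    generalize (y : ZMod 4) = v at *
    revert u v
    decide
  have hS : (((bopS A N).card : ℕ) : ZMod 4) = 0 := by
    rw [bop_S_card]
    push_cast
    refine Finset.sum_involution (fun p _ => p.swap) ?_ ?_ ?_ ?_
    · rintro ⟨i, j⟩ hij
      rw [Finset.HasAntidiagonal.mem_antidiagonal] at hij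
      simp only at hij
      have he : Even ((bopP A i).card * (bopP A j).card) := by
        have : (i % 4 = 2 ∨ i % 4 = 3) ∨ (j % 4 = 2 ∨ j % 4 = 3) := by omega
        rcases this with h | h
        · exact (heven i h).mul_right _
        · exact (heven j h).mul_left _
      obtain ⟨c, hc⟩ := he
      simp only [Prod.swap_prod_mk]
      have : (((bopP A i).card * (bopP A j).card : ℕ) : ZMod 4) = c + c := by
        rw [hc]; push_cast; ring
      push_cast at this
      rw [mul_comm ((bopP A j).card : ZMod 4), this]
      generalize (c : ZMod 4) = u
      revert u
      decide
    · rintro ⟨i, j⟩ hij _ he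
      rw [Finset.HasAntidiagonal.mem_antidiagonal] at hij
      simp only [Prod.swap_prod_mk, Prod.mk.injEq] at he hij
      omega
    · rintro ⟨i, j⟩ hij
      rw [Finset.HasAntidiagonal.mem_antidiagonal] at hij ⊢
      simp only [Prod.swap_prod_mk] at hij ⊢
      omega
    · intros; rfl
  have hd := bop_diag A N (by omega)
  have hsplit := Finset.card_filter_add_card_filter_not (s := bopS A N) (fun p => p.1.1 = p.2.1)
  have hsum : ∑ p ∈ bopP A N, (p.2 - 1) + (bopP A N).card = ∑ p ∈ bopP A N, p.2 := by
    rw [Finset.card_eq_sum_ones, ← Finset.sum_add_distrib]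
    refine Finset.sum_congr rfl fun p hp => ?_
    rw [mem_bopP] at hp
    have : p.2 ≠ 0 := by
      intro h0
      rw [h0, mul_zero] at hp
      omega
    omega
  rw [ZMod.natCast_eq_zero_iff] at hσ hS
  obtain ⟨c, hc⟩ := heven N (Or.inr hN)
  have hmod := bop_mod8 A N (by omega)
  have hcard := bop_ncard A N
  unfold biregularOverpartitions
  rw [hcard, Nat.dvd_iff_mod_eq_zero, hmod]
  simp only [ne_eq]
  omega
end

section
/- Let α ≥ 2, β ≥ 1 and n ≥ 0 be integers. If α and β have different parity, or α and β are both even, then the number of (2^α, 3^β)-biregular overpartitions of 12n+11 is divisible by 8, i.e. B̄_{2^α,3^β}(12n+11) ≡ 0 (mod 8). -/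
lemma sq_of_odd (m : ℕ) (h : Odd m.divisors.card) : ∃ x, m = x ^ 2 := by
  by_contra hc
  push Not at hc
  have : ∑ d ∈ m.divisors, (1 : ZMod 2) = 0 := by
    refine Finset.sum_involution (fun d _ => m / d) ?_ ?_ ?_ ?_
    · intros; decide
    · intro d hd _ he
      have := Nat.mul_div_cancel' (Nat.dvd_of_mem_divisors hd)
      rw [he] at this
      exact hc d (by rw [sq, this])
    · intro d hd
      have := Nat.mem_divisors.1 hd
      exact Nat.mem_divisors.2 ⟨Nat.div_dvd_of_dvd this.1, this.2⟩
    · intro d hd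
      have := Nat.mem_divisors.1 hd
      exact Nat.div_div_self this.1 this.2
  simp [ZMod.natCast_eq_zero_iff] at this
  exact Nat.not_even_iff_odd.2 h (even_iff_two_dvd.2 this)

lemma sigma4 (N : ℕ) (hN : N % 4 = 3) : 4 ∣ ∑ d ∈ N.divisors, d := by
  have : ∑ d ∈ N.divisors, (d : ZMod 4) = 0 := by
    have key : ∀ d ∈ N.divisors, (d : ZMod 4) * ((N / d : ℕ) : ZMod 4) = 3 := by
      intro d hd
      have := Nat.mul_div_cancel' (Nat.dvd_of_mem_divisors hd)
      rw [← Nat.cast_mul, this, ← ZMod.natCast_mod, hN]; rfl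
    refine Finset.sum_involution (fun d _ => N / d) ?_ ?_ ?_ ?_
    · intro d hd
      have := key d hd
      revert this
      generalize (d : ZMod 4) = x
      generalize ((N / d : ℕ) : ZMod 4) = y
      revert x y; decide
    · intro d hd _ he
      have := key d hd
      rw [he] at this
      revert this
      generalize (d : ZMod 4) = x
      revert x; decide
    · intro d hd
      have := Nat.mem_divisors.1 hd
      exact Nat.mem_divisors.2 ⟨Nat.div_dvd_of_dvd this.1, this.2⟩
    · intro d hd
      have := Nat.mem_divisors.1 hd
      exact Nat.div_div_self this.1 this.2
  rw [← ZMod.natCast_eq_zero_iff]; push_cast; exact this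

lemma cdiv (m c : ℕ) (hc : 0 < c) (h : Odd (m.divisors.filter (fun j => c ∣ j)).card) :
    ∃ x, m = c * x ^ 2 := by
  have hne : (m.divisors.filter (fun j => c ∣ j)).Nonempty := by
    rw [← Finset.card_pos]; exact h.pos
  obtain ⟨j, hj⟩ := hne
  rw [Finset.mem_filter, Nat.mem_divisors] at hj
  obtain ⟨m1, rfl⟩ := hj.2.trans hj.1.1
  have : ((c * m1).divisors.filter (fun j => c ∣ j)) = m1.divisors.image (c * ·) := by
    ext k
    simp only [Finset.mem_filter, Nat.mem_divisors, Finset.mem_image]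
    constructor
    · rintro ⟨⟨h1, h2⟩, ⟨k, rfl⟩⟩
      exact ⟨k, ⟨Nat.dvd_of_mul_dvd_mul_left hc h1, by rintro rfl; simp at h2⟩, rfl⟩
    · rintro ⟨k, ⟨h1, h2⟩, rfl⟩
      exact ⟨⟨Nat.mul_dvd_mul_left c h1, by positivity⟩, dvd_mul_right _ _⟩
  rw [this, Finset.card_image_of_injective _ (mul_right_injective₀ hc.ne')] at h
  obtain ⟨x, hx⟩ := sq_of_odd _ h
  exact ⟨x, by rw [hx]⟩

def dA (a b m : ℕ) : Finset ℕ := m.divisors.filter (fun j => ¬ a ∣ j ∧ ¬ b ∣ j)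

lemma dA_odd (a b m : ℕ) (ha : 0 < a) (hb : 0 < b) (hab : Nat.Coprime a b)
    (h : Odd (dA a b m).card) :
    ∃ x, m = 1 * x ^ 2 ∨ m = a * x ^ 2 ∨ m = b * x ^ 2 ∨ m = (a * b) * x ^ 2 := by
  have ie : (m.divisors.filter (fun j => 1 ∣ j)).card + (m.divisors.filter (fun j => a * b ∣ j)).card
      = (dA a b m).card + (m.divisors.filter (fun j => a ∣ j)).card
        + (m.divisors.filter (fun j => b ∣ j)).card := by
    simp only [dA, Finset.card_filter, ← Finset.sum_add_distrib]
    refine Finset.sum_congr rfl fun j _ => ?_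
    have : a * b ∣ j ↔ a ∣ j ∧ b ∣ j :=
      ⟨fun h => ⟨(dvd_mul_right _ _).trans h, (dvd_mul_left _ _).trans h⟩,
        fun h => hab.mul_dvd_of_dvd_of_dvd h.1 h.2⟩
    rw [if_congr this rfl rfl]
    by_cases h1 : a ∣ j <;> by_cases h2 : b ∣ j <;> simp [h1, h2]
  by_contra hc
  push Not at hc
  have e1 := mt (cdiv m 1 one_pos) (by rintro ⟨x, hx⟩; exact (hc x).1 hx)
  have e2 := mt (cdiv m a ha) (by rintro ⟨x, hx⟩; exact (hc x).2.1 hx)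
  have e3 := mt (cdiv m b hb) (by rintro ⟨x, hx⟩; exact (hc x).2.2.1 hx)
  have e4 := mt (cdiv m (a*b) (Nat.mul_pos ha hb)) (by rintro ⟨x, hx⟩; exact (hc x).2.2.2 hx)
  rw [Nat.not_odd_iff] at e1 e2 e3 e4
  rw [Nat.odd_iff] at h
  omega

lemma pow12 (α β : ℕ) (hα : 2 ≤ α) (hβ : 1 ≤ β)
    (h : (Odd α ∧ Even β) ∨ (Even α ∧ Odd β) ∨ (Even α ∧ Even β)) :
    ((2 ^ α : ZMod 12) = 8 ∧ (3 ^ β : ZMod 12) = 9) ∨ ((2 ^ α : ZMod 12) = 4 ∧ (3 ^ β : ZMod 12) = 3)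
    ∨ ((2 ^ α : ZMod 12) = 4 ∧ (3 ^ β : ZMod 12) = 9) := by
  have p4 : ∀ k, (4 : ZMod 12) ^ (k + 1) = 4 := by
    intro k; induction k with
    | zero => rfl
    | succ k ih => rw [pow_succ, ih]; rfl
  have p9 : ∀ k, (9 : ZMod 12) ^ (k + 1) = 9 := by
    intro k; induction k with
    | zero => rfl
    | succ k ih => rw [pow_succ, ih]; rfl
  have ae : Even α → (2 ^ α : ZMod 12) = 4 := by
    rintro ⟨k, rfl⟩
    obtain ⟨k, rfl⟩ : ∃ l, k = l + 1 := ⟨k - 1, by omega⟩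
    rw [← two_mul, pow_mul, ← p4 k]; rfl
  have ao : Odd α → (2 ^ α : ZMod 12) = 8 := by
    rintro ⟨k, rfl⟩
    obtain ⟨k, rfl⟩ : ∃ l, k = l + 1 := ⟨k - 1, by omega⟩
    rw [pow_succ, pow_mul, show (2 : ZMod 12) ^ 2 = 4 from rfl, p4 k]; rfl
  have be : Even β → (3 ^ β : ZMod 12) = 9 := by
    rintro ⟨k, rfl⟩
    obtain ⟨k, rfl⟩ : ∃ l, k = l + 1 := ⟨k - 1, by omega⟩
    rw [← two_mul, pow_mul, show (3 : ZMod 12) ^ 2 = 9 from rfl, p9 k]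
  have bo : Odd β → (3 ^ β : ZMod 12) = 3 := by
    rintro ⟨k, rfl⟩
    rcases k with _ | k
    · rfl
    rw [pow_succ, pow_mul, show (3 : ZMod 12) ^ 2 = 9 from rfl, p9 k]; rfl
  tauto

lemma dA_prod (n α β : ℕ) (hα : 2 ≤ α) (hβ : 1 ≤ β)
    (h : (Odd α ∧ Even β) ∨ (Even α ∧ Odd β) ∨ (Even α ∧ Even β)) (m m' : ℕ)
    (hm : m + m' = 12 * n + 11) :
    2 ∣ (dA (2 ^ α) (3 ^ β) m).card * (dA (2 ^ α) (3 ^ β) m').card := by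
  have cop : Nat.Coprime (2 ^ α) (3 ^ β) := Nat.Coprime.pow _ _ (by norm_num)
  rw [← even_iff_two_dvd, ← Nat.not_odd_iff_even, Nat.odd_mul]
  rintro ⟨h1, h2⟩
  obtain ⟨x, hx⟩ := dA_odd _ _ _ (by positivity) (by positivity) cop h1
  obtain ⟨y, hy⟩ := dA_odd _ _ _ (by positivity) (by positivity) cop h2
  have hm2 : (m : ZMod 12) + m' = 11 := by
    rw [← Nat.cast_add, hm]; push_cast
    rw [show (12 : ZMod 12) = 0 from rfl]; ring
  have key : ∀ c c' : ℕ, m = c * x ^ 2 → m' = c' * y ^ 2 →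
      (c : ZMod 12) * x ^ 2 + c' * y ^ 2 = 11 := by
    intro c c' e e'
    rw [e, e'] at hm2; exact_mod_cast hm2
  have fin : ∀ a b : ZMod 12, ((a = 8 ∧ b = 9) ∨ (a = 4 ∧ b = 3) ∨ (a = 4 ∧ b = 9)) →
      ∀ c c' : ZMod 12, (c = 1 ∨ c = a ∨ c = b ∨ c = a * b) →
      (c' = 1 ∨ c' = a ∨ c' = b ∨ c' = a * b) → ∀ x y : ZMod 12, c * x ^ 2 + c' * y ^ 2 ≠ 11 := by
    have sq : ∀ x : ZMod 12, x ^ 2 = 0 ∨ x ^ 2 = 1 ∨ x ^ 2 = 4 ∨ x ^ 2 = 9 := by decide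
    intro a b hab c c' hc hc' x y
    rcases hab with ⟨rfl, rfl⟩ | ⟨rfl, rfl⟩ | ⟨rfl, rfl⟩ <;>
    rcases hc with rfl | rfl | rfl | rfl <;> rcases hc' with rfl | rfl | rfl | rfl <;>
    rcases sq x with e | e | e | e <;> rcases sq y with e' | e' | e' | e' <;>
    rw [e, e'] <;> decide
  have red : ∀ z w : ℕ, (z = 1 * w ^ 2 ∨ z = 2 ^ α * w ^ 2 ∨ z = 3 ^ β * w ^ 2 ∨
      z = (2 ^ α * 3 ^ β) * w ^ 2) → ∃ c : ℕ, z = c * w ^ 2 ∧ ((c : ZMod 12) = 1 ∨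
      (c : ZMod 12) = 2 ^ α ∨ (c : ZMod 12) = 3 ^ β ∨ (c : ZMod 12) = 2 ^ α * 3 ^ β) := by
    intro z w hz
    rcases hz with hz | hz | hz | hz
    · exact ⟨_, hz, by simp⟩
    · exact ⟨_, hz, by simp⟩
    · exact ⟨_, hz, by simp⟩
    · exact ⟨_, hz, by simp⟩
  obtain ⟨c, hc, hc2⟩ := red _ _ hx
  obtain ⟨c', hc', hc2'⟩ := red _ _ hy
  exact fin _ _ (pow12 α β hα hβ h) _ _ hc2 hc2' x y (key c c' hc hc')

lemma diag_j (N j : ℕ) (hN : N % 2 = 1) (hj : j ∣ N) :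
    2 * ((Finset.range N).filter (fun m => Even m ∧ m ≠ 0 ∧ j ∣ m)).card + 1 = N / j := by
  obtain ⟨q, rfl⟩ := hj
  have hj0 : 0 < j := by rcases j with _ | j; · simp at hN
                         · omega
  have hodd : Odd j ∧ Odd q := by rw [← Nat.odd_mul, Nat.odd_iff]; exact hN
  rw [Nat.mul_div_cancel_left _ hj0]
  have : (Finset.range ((q-1)/2)).card
      = ((Finset.range (j*q)).filter (fun m => Even m ∧ m ≠ 0 ∧ j ∣ m)).card := by
    refine Finset.card_nbij (fun t => j * (2 * t + 2)) ?_ ?_ ?_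
    · intro t ht
      simp only [Finset.coe_range, Set.mem_Iio] at ht
      simp only [Finset.coe_filter, Finset.mem_range, Set.mem_ofPred_eq]
      refine ⟨Nat.mul_lt_mul_of_pos_left (by omega) hj0, ?_, by positivity, dvd_mul_right _ _⟩
      exact Even.mul_left (by rw [Nat.even_iff]; omega) _
    · intro t _ t' _ e
      have := Nat.eq_of_mul_eq_mul_left hj0 e
      omega
    · intro m hm
      simp only [Finset.coe_filter, Finset.mem_range, Set.mem_ofPred_eq] at hm
      obtain ⟨h1, h2, h3, ⟨s, rfl⟩⟩ := hm
      have hs : Even s := by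
        rcases Nat.even_mul.1 h2 with h | h
        · exact absurd h (Nat.not_even_iff_odd.2 hodd.1)
        · exact h
      have hs0 : s ≠ 0 := by rintro rfl; simp at h3
      have hsq := Nat.lt_of_mul_lt_mul_left h1
      obtain ⟨u, rfl⟩ := hs
      refine ⟨u - 1, ?_, ?_⟩
      · simp; omega
      · simp only; congr 1; omega
  rw [← this, Finset.card_range]
  obtain ⟨u, rfl⟩ := hodd.2
  omega

lemma diag_count (a b N : ℕ) (hN : N % 2 = 1) (hA : ∀ j ∈ N.divisors, ¬ a ∣ j ∧ ¬ b ∣ j) :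
    2 * (∑ m ∈ (Finset.range N).filter Even,
      ((dA a b m ×ˢ dA a b (N - m)).filter (fun p => p.1 = p.2)).card) + N.divisors.card
      = ∑ d ∈ N.divisors, d := by
  have h1 : ∀ m ∈ (Finset.range N).filter Even,
      ((dA a b m ×ˢ dA a b (N - m)).filter (fun p => p.1 = p.2)).card
      = (N.divisors.filter (fun j => m ≠ 0 ∧ j ∣ m)).card := by
    intro m hm
    simp only [Finset.mem_filter, Finset.mem_range] at hm
    symm
    refine Finset.card_nbij (fun j => (j, j)) ?_ ?_ ?_
    · intro j hj
      simp only [Finset.coe_filter, Set.mem_ofPred_eq] at hj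
      have hA' := hA j hj.1
      simp only [Finset.coe_filter, Set.mem_ofPred_eq, Finset.mem_product, dA, Finset.mem_filter,
        Nat.mem_divisors, and_true]
      exact ⟨⟨⟨hj.2.2, hj.2.1⟩, hA'⟩, ⟨Nat.dvd_sub (Nat.dvd_of_mem_divisors hj.1) hj.2.2,
        by omega⟩, hA'⟩
    · intro j _ j' _ e
      exact (Prod.ext_iff.1 e).1
    · rintro ⟨j, k⟩ hj
      simp only [Finset.coe_filter, Set.mem_ofPred_eq, Finset.mem_product, dA, Finset.mem_filter,
        Nat.mem_divisors] at hj
      obtain ⟨⟨⟨⟨a1, a2⟩, a3⟩, ⟨a4, a5⟩, a6⟩, rfl⟩ := hj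
      refine ⟨j, ?_, rfl⟩
      simp only [Finset.coe_filter, Set.mem_ofPred_eq, Nat.mem_divisors]
      refine ⟨⟨?_, by omega⟩, a2, a1⟩
      have := Nat.dvd_add a1 a4
      rwa [Nat.add_sub_cancel' hm.1.le] at this
  rw [Finset.sum_congr rfl h1]
  have h2 : ∑ m ∈ (Finset.range N).filter Even, (N.divisors.filter (fun j => m ≠ 0 ∧ j ∣ m)).card
      = ∑ j ∈ N.divisors, ((Finset.range N).filter (fun m => Even m ∧ m ≠ 0 ∧ j ∣ m)).card := by
    simp only [Finset.card_filter, Finset.sum_filter]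
    rw [Finset.sum_comm]
    refine Finset.sum_congr rfl fun m _ => ?_
    by_cases h : Even m <;> simp [h]
  rw [h2, Finset.mul_sum, Finset.card_eq_sum_ones, ← Finset.sum_add_distrib,
    Finset.sum_congr rfl (fun j hj => diag_j N j hN (Nat.dvd_of_mem_divisors hj)),
    Nat.sum_div_divisors N (fun d => d)]

def PA (a b N : ℕ) : Finset (Multiset ℕ) :=
  ((Finset.univ : Finset N.Partition).image Nat.Partition.parts).filter
    (fun l => ∀ x ∈ l, ¬ a ∣ x ∧ ¬ b ∣ x)

lemma mem_PA (a b N : ℕ) (l : Multiset ℕ) :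
    l ∈ PA a b N ↔ (∀ x ∈ l, 0 < x ∧ ¬ a ∣ x ∧ ¬ b ∣ x) ∧ l.sum = N := by
  simp only [PA, Finset.mem_filter, Finset.mem_image, Finset.mem_univ, true_and]
  constructor
  · rintro ⟨⟨p, rfl⟩, h⟩
    exact ⟨fun x hx => ⟨p.parts_pos hx, h x hx⟩, p.parts_sum⟩
  · rintro ⟨h, hs⟩
    exact ⟨⟨⟨l, fun {i} hi => (h i hi).1, hs⟩, rfl⟩, fun x hx => (h x hx).2⟩

lemma count_eq_s9 (a b N : ℕ) :
    biregularOverpartitions a b N = ∑ l ∈ PA a b N, 2 ^ l.toFinset.card := by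
  have hle : ∀ (l : Multiset ℕ) (T : Finset ℕ), T ⊆ l.toFinset → T.val ≤ l := by
    intro l T h
    rw [Multiset.le_iff_subset T.nodup]
    intro x hx
    exact Multiset.mem_toFinset.1 (h hx)
  have : ((PA a b N).sigma (fun l => l.toFinset.powerset)).card
      = ∑ l ∈ PA a b N, 2 ^ l.toFinset.card := by
    rw [Finset.card_sigma]; simp only [Finset.card_powerset]
  rw [← this, biregularOverpartitions, ← Set.ncard_coe_finset]
  symm
  refine Set.ncard_congr (fun x _ => (x.1 - x.2.val, x.2.val)) ?_ ?_ ?_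
  · rintro ⟨l, T⟩ h
    simp only [Finset.coe_sigma, Set.mem_sigma_iff, Finset.mem_coe, Finset.mem_powerset] at h
    obtain ⟨h1, h2⟩ := h
    rw [mem_PA] at h1
    have h3 := hle l T h2
    refine ⟨fun x hx => h1.1 x (Multiset.mem_of_le (Multiset.sub_le_self _ _) hx),
      fun x hx => h1.1 x (Multiset.mem_of_le h3 hx), T.nodup, ?_⟩
    rw [← Multiset.sum_add, Multiset.sub_add_cancel h3, h1.2]
  · rintro ⟨l, T⟩ ⟨l', T'⟩ h h' e
    simp only [Finset.coe_sigma, Set.mem_sigma_iff, Finset.mem_coe, Finset.mem_powerset] at h h'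
    simp only [Prod.mk.injEq, Finset.val_inj] at e
    obtain ⟨e1, rfl⟩ := e
    have : l = l' := by
      rw [← Multiset.sub_add_cancel (hle l T h.2), e1, Multiset.sub_add_cancel (hle l' T h'.2)]
    subst this; rfl
  · rintro ⟨s, t⟩ ⟨h1, h2, h3, h4⟩
    refine ⟨⟨s + t, ⟨t, h3⟩⟩, ?_, ?_⟩
    · simp only [Finset.coe_sigma, Set.mem_sigma_iff, Finset.mem_coe, Finset.mem_powerset]
      refine ⟨(mem_PA _ _ _ _).2 ⟨?_, by rw [Multiset.sum_add]; exact h4⟩, ?_⟩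
      · intro x hx
        rcases Multiset.mem_add.1 hx with hx | hx
        · exact h1 x hx
        · exact h2 x hx
      · intro x hx
        rw [Multiset.mem_toFinset, Multiset.mem_add]
        exact Or.inr hx
    · simp

lemma count_one (a b N : ℕ) (hN : 0 < N) (hA : ∀ j ∈ N.divisors, ¬ a ∣ j ∧ ¬ b ∣ j) :
    ((PA a b N).filter (fun l => l.toFinset.card = 1)).card = N.divisors.card := by
  symm
  refine Finset.card_nbij (fun j => Multiset.replicate (N / j) j) ?_ ?_ ?_
  · intro j hj
    have hj' := Nat.mem_divisors.1 hj
    have hj0 : 0 < j := Nat.pos_of_mem_divisors hj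
    have hq : N / j ≠ 0 := (Nat.div_pos (Nat.le_of_dvd hN hj'.1) hj0).ne'
    simp only [Finset.coe_filter, Set.mem_ofPred_eq, mem_PA]
    refine ⟨⟨?_, ?_⟩, ?_⟩
    · intro x hx
      rw [Multiset.eq_of_mem_replicate hx]
      exact ⟨hj0, hA j hj⟩
    · rw [Multiset.sum_replicate, smul_eq_mul, Nat.div_mul_cancel hj'.1]
    · rw [Multiset.toFinset_replicate, if_neg hq, Finset.card_singleton]
  · intro j hj k hk e
    have hj' := Nat.mem_divisors.1 hj
    have hq : N / j ≠ 0 :=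
      (Nat.div_pos (Nat.le_of_dvd hN hj'.1) (Nat.pos_of_mem_divisors hj)).ne'
    have : j ∈ Multiset.replicate (N / j) j := Multiset.mem_replicate.2 ⟨hq, rfl⟩
    simp only at e
    rw [e] at this
    exact Multiset.eq_of_mem_replicate this
  · intro l hl
    simp only [Finset.coe_filter, Set.mem_ofPred_eq, mem_PA] at hl
    obtain ⟨⟨h1, h2⟩, h3⟩ := hl
    obtain ⟨x, hx⟩ := Finset.card_eq_one.1 h3
    have hl := Multiset.toFinset_sum_count_nsmul_eq l
    rw [hx, Finset.sum_singleton, Multiset.nsmul_singleton] at hl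
    have hxl : x ∈ l := by rw [← Multiset.mem_toFinset, hx]; simp
    have hs : Multiset.count x l * x = N := by
      rw [← h2]; conv_rhs => rw [← hl]
      simp
    refine ⟨x, ?_, ?_⟩
    · simp only [Finset.mem_coe, Nat.mem_divisors]
      exact ⟨⟨_, by rw [mul_comm]; exact hs.symm⟩, hN.ne'⟩
    · simp only
      rw [← hs, Nat.mul_div_cancel _ (h1 x hxl).1, hl]

lemma count_two (a b N : ℕ) (hN : N % 2 = 1) :
    ((PA a b N).filter (fun l => l.toFinset.card = 2)).card =
    (((Finset.range N).filter Even).sigma (fun m =>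
      (dA a b m ×ˢ dA a b (N - m)).filter (fun p => ¬ p.1 = p.2))).card := by
  symm
  refine Finset.card_nbij (fun x => Multiset.replicate (x.1 / x.2.1) x.2.1 +
    Multiset.replicate ((N - x.1) / x.2.2) x.2.2) ?_ ?_ ?_
  · rintro ⟨m, j, k⟩ h
    simp only [Finset.coe_sigma, Set.mem_sigma_iff, Finset.mem_coe, Finset.mem_filter, dA,
      Finset.mem_product, Nat.mem_divisors, Finset.mem_range] at h
    obtain ⟨⟨h1, h2⟩, ⟨⟨⟨h3, h4⟩, h5⟩, ⟨h6, h7⟩, h8⟩, h9⟩ := h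
    have hj0 : 0 < j := Nat.pos_of_dvd_of_pos h3 (by omega)
    have hk0 : 0 < k := Nat.pos_of_dvd_of_pos h6 (by omega)
    have hq : m / j ≠ 0 := (Nat.div_pos (Nat.le_of_dvd (by omega) h3) hj0).ne'
    have hq' : (N - m) / k ≠ 0 := (Nat.div_pos (Nat.le_of_dvd (by omega) h6) hk0).ne'
    simp only [Finset.coe_filter, Set.mem_ofPred_eq, mem_PA]
    refine ⟨⟨?_, ?_⟩, ?_⟩
    · intro x hx
      rcases Multiset.mem_add.1 hx with hx | hx <;> rw [Multiset.eq_of_mem_replicate hx]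
      · exact ⟨hj0, h5⟩
      · exact ⟨hk0, h8⟩
    · rw [Multiset.sum_add, Multiset.sum_replicate, Multiset.sum_replicate, smul_eq_mul,
        smul_eq_mul, Nat.div_mul_cancel h3, Nat.div_mul_cancel h6]
      omega
    · rw [Multiset.toFinset_add, Multiset.toFinset_replicate, Multiset.toFinset_replicate,
        if_neg hq, if_neg hq']
      exact Finset.card_pair h9
  · rintro ⟨m, j, k⟩ h ⟨m', j', k'⟩ h' e
    simp only [Finset.coe_sigma, Set.mem_sigma_iff, Finset.mem_coe, Finset.mem_filter, dA,
      Finset.mem_product, Nat.mem_divisors, Finset.mem_range] at h h'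
    obtain ⟨⟨h1, h2⟩, ⟨⟨⟨h3, h4⟩, h5⟩, ⟨h6, h7⟩, h8⟩, h9⟩ := h
    obtain ⟨⟨h1', h2'⟩, ⟨⟨⟨h3', h4'⟩, h5'⟩, ⟨h6', h7'⟩, h8'⟩, h9'⟩ := h'
    have hj0 : 0 < j := Nat.pos_of_dvd_of_pos h3 (by omega)
    have hk0 : 0 < k := Nat.pos_of_dvd_of_pos h6 (by omega)
    have hq : m / j ≠ 0 := (Nat.div_pos (Nat.le_of_dvd (by omega) h3) hj0).ne'
    have hq' : (N - m) / k ≠ 0 := (Nat.div_pos (Nat.le_of_dvd (by omega) h6) hk0).ne'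
    simp only at e
    have ej := congrArg (Multiset.count j) e
    have ek := congrArg (Multiset.count k) e
    simp only [Multiset.count_add, Multiset.count_replicate, if_true, if_neg h9,
      if_neg (Ne.symm h9)] at ej ek
    have d1 := Nat.div_mul_cancel h3
    have d2 := Nat.div_mul_cancel h6
    have d1' := Nat.div_mul_cancel h3'
    have d2' := Nat.div_mul_cancel h6'
    rw [Nat.even_iff] at h2 h2'
    by_cases c1 : j' = j
    · subst c1
      have c2 : ¬ k' = j' := Ne.symm h9'
      rw [if_pos rfl, if_neg c2] at ej
      have : m = m' := by rw [← d1, ← d1']; congr 1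
      subst this
      rw [if_neg h9] at ek
      by_cases c3 : k' = k
      · subst c3; rfl
      · rw [if_neg c3] at ek; omega
    · rw [if_neg c1] at ej
      by_cases c2 : k' = j
      · subst c2
        rw [if_pos rfl] at ej
        have : m = N - m' := by rw [← d1, ← d2']; congr 1; omega
        omega
      · rw [if_neg c2] at ej; omega
  · intro l hl
    simp only [Finset.coe_filter, Set.mem_ofPred_eq, mem_PA] at hl
    obtain ⟨⟨h1, h2⟩, h3⟩ := hl
    obtain ⟨x, y, hxy, hx⟩ := Finset.card_eq_two.1 h3
    have hl := Multiset.toFinset_sum_count_nsmul_eq l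
    rw [hx, Finset.sum_pair hxy, Multiset.nsmul_singleton, Multiset.nsmul_singleton] at hl
    have hxl : x ∈ l := by rw [← Multiset.mem_toFinset, hx]; simp
    have hyl : y ∈ l := by rw [← Multiset.mem_toFinset, hx]; simp
    have hs : Multiset.count x l * x + Multiset.count y l * y = N := by
      rw [← h2]; conv_rhs => rw [← hl]
      simp
    have hcx := Multiset.count_pos.2 hxl
    have hcy := Multiset.count_pos.2 hyl
    have gen : ∀ x y r s : ℕ, x ∈ l → y ∈ l → x ≠ y → 0 < r → 0 < s → r * x + s * y = N →
        Multiset.replicate r x + Multiset.replicate s y = l → Even (r * x) →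
        l ∈ (fun x : (_ : ℕ) × ℕ × ℕ => Multiset.replicate (x.1 / x.2.1) x.2.1 +
          Multiset.replicate ((N - x.1) / x.2.2) x.2.2) '' ↑(((Finset.range N).filter Even).sigma
          (fun m => (dA a b m ×ˢ dA a b (N - m)).filter (fun p => ¬ p.1 = p.2))) := by
      intro x y r s hx hy hxy hr hs e hl he
      have px := h1 x hx
      have py := h1 y hy
      have p1 : 0 < r * x := Nat.mul_pos hr px.1
      have p2 : 0 < s * y := Nat.mul_pos hs py.1
      have e2 : N - r * x = s * y := by omega
      refine ⟨⟨r * x, x, y⟩, ?_, ?_⟩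
      · simp only [Finset.coe_sigma, Set.mem_sigma_iff, Finset.mem_coe, Finset.mem_filter, dA,
          Finset.mem_product, Nat.mem_divisors, Finset.mem_range, e2]
        exact ⟨⟨by omega, he⟩, ⟨⟨⟨dvd_mul_left _ _, p1.ne'⟩, px.2⟩,
          ⟨dvd_mul_left _ _, p2.ne'⟩, py.2⟩, hxy⟩
      · simp only [e2, Nat.mul_div_cancel _ px.1, Nat.mul_div_cancel _ py.1, hl]
    rcases Nat.even_or_odd (Multiset.count x l * x) with he | ho
    · exact gen x y _ _ hxl hyl hxy hcx hcy hs hl he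
    · refine gen y x _ _ hyl hxl hxy.symm hcy hcx (by omega) (by rw [add_comm]; exact hl) ?_
      rw [Nat.odd_iff] at ho
      rw [Nat.even_iff]; omega

lemma sum_mod8 (a b N : ℕ) (hN : 0 < N) :
    ∃ K, ∑ l ∈ PA a b N, 2 ^ l.toFinset.card =
      2 * ((PA a b N).filter (fun l => l.toFinset.card = 1)).card +
      4 * ((PA a b N).filter (fun l => l.toFinset.card = 2)).card + 8 * K := by
  refine ⟨∑ l ∈ PA a b N, if 3 ≤ l.toFinset.card then 2 ^ (l.toFinset.card - 3) else 0, ?_⟩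
  simp only [Finset.card_filter, Finset.mul_sum, ← Finset.sum_add_distrib]
  refine Finset.sum_congr rfl fun l hl => ?_
  have h0 : l.toFinset.card ≠ 0 := by
    intro h
    rw [Finset.card_eq_zero, Multiset.toFinset_eq_empty] at h
    have := ((mem_PA _ _ _ _).1 hl).2
    rw [h] at this; simp at this; omega
  generalize l.toFinset.card = c at *
  rcases c with _ | _ | _ | c
  · omega
  · simp
  · simp
  · simp [pow_succ]; ring

theorem biregular_overpartition_pow2_pow3_12n11_mod8 (n α β : ℕ) (hα : 2 ≤ α) (hβ : 1 ≤ β)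
    (h : (Odd α ∧ Even β) ∨ (Even α ∧ Odd β) ∨ (Even α ∧ Even β)) :
    8 ∣ biregularOverpartitions (2 ^ α) (3 ^ β) (12 * n + 11) := by
  have hA : ∀ j ∈ (12 * n + 11).divisors, ¬ 2 ^ α ∣ j ∧ ¬ 3 ^ β ∣ j := by
    intro j hj
    have hj := Nat.dvd_of_mem_divisors hj
    refine ⟨fun hc => ?_, fun hc => ?_⟩
    · have := ((dvd_pow_self 2 (by omega)).trans hc).trans hj
      omega
    · have := ((dvd_pow_self 3 (by omega)).trans hc).trans hj
      omega
  obtain ⟨K, hK⟩ := sum_mod8 (2 ^ α) (3 ^ β) (12 * n + 11) (by omega)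
  rw [count_eq_s9, hK, count_one _ _ _ (by omega) hA, count_two _ _ _ (by omega), Finset.card_sigma]
  have hd := diag_count (2 ^ α) (3 ^ β) (12 * n + 11) (by omega) hA
  have hs := sigma4 (12 * n + 11) (by omega)
  have he : 2 ∣ (12 * n + 11).divisors.card := by
    rw [← even_iff_two_dvd, ← Nat.not_odd_iff_even]
    intro ho
    obtain ⟨x, hx⟩ := sq_of_odd _ ho
    rcases Nat.even_or_odd' x with ⟨y, rfl | rfl⟩
    · have : (2 * y) ^ 2 = 4 * y ^ 2 := by ring
      omega
    · have : (2 * y + 1) ^ 2 = 4 * (y ^ 2 + y) + 1 := by ring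
      omega
  have hp : 2 ∣ ∑ m ∈ (Finset.range (12 * n + 11)).filter Even,
      (dA (2 ^ α) (3 ^ β) m ×ˢ dA (2 ^ α) (3 ^ β) (12 * n + 11 - m)).card := by
    refine Finset.dvd_sum fun m hm => ?_
    rw [Finset.card_product]
    simp only [Finset.mem_filter, Finset.mem_range] at hm
    exact dA_prod n α β hα hβ h _ _ (by omega)
  have hsplit : ∑ m ∈ (Finset.range (12 * n + 11)).filter Even,
      (dA (2 ^ α) (3 ^ β) m ×ˢ dA (2 ^ α) (3 ^ β) (12 * n + 11 - m)).card =
      ∑ m ∈ (Finset.range (12 * n + 11)).filter Even,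
      ((dA (2 ^ α) (3 ^ β) m ×ˢ dA (2 ^ α) (3 ^ β) (12 * n + 11 - m)).filter
        (fun p => p.1 = p.2)).card +
      ∑ m ∈ (Finset.range (12 * n + 11)).filter Even,
      ((dA (2 ^ α) (3 ^ β) m ×ˢ dA (2 ^ α) (3 ^ β) (12 * n + 11 - m)).filter
        (fun p => ¬ p.1 = p.2)).card := by
    rw [← Finset.sum_add_distrib]
    exact Finset.sum_congr rfl fun m _ => (Finset.card_filter_add_card_filter_not _).symm
  omega
end
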